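/- arXiv:2302.00964 — 2 statements merged into one kernel-verified Lean document; each statement's English description precedes it below -/
import Mathlib

section
/- For every integer n ≥ 1, δ₄(1,1,2,4; n−1) = Σ_{d∣n} χ₈(n/d)·d; that is, the number of quadruples (x₁,x₂,x₃,x₄) of nonnegative integers with n − 1 = x₁(x₁+1)/2 + x₂(x₂+1)/2 + 2·x₃(x₃+1)/2 + 4·x₄(x₄+1)/2 equals Σ_{d∣n} χ₈(n/d)·d. -/
/-- `deltaRep k c n` is the number of `k`-tuples `(x₁, …, x_k)` of nonnegative integers
with `n = Σᵢ cᵢ · xᵢ(xᵢ+1)/2`. -/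
noncomputable def deltaRep (k : ℕ) (c : Fin k → ℕ) (n : ℕ) : ℕ :=
  Set.ncard {x : Fin k → ℕ | n = ∑ i, c i * (x i * (x i + 1) / 2)}

/-- `rRep v b n` is the number of `v`-tuples `(y₁, …, y_v)` of integers with
`n = Σᵢ bᵢ · yᵢ²`. -/
noncomputable def rRep (v : ℕ) (b : Fin v → ℕ) (n : ℕ) : ℕ :=
  Set.ncard {y : Fin v → ℤ | (n : ℤ) = ∑ i, (b i : ℤ) * y i ^ 2}

/-- `qRep k c n` is the number of `k`-tuples `(y₁, …, y_k)` of positive odd integers with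
`n = Σᵢ cᵢ · yᵢ²`. -/
noncomputable def qRep (k : ℕ) (c : Fin k → ℕ) (n : ℕ) : ℕ :=
  Set.ncard {y : Fin k → ℕ | (∀ i, 0 < y i ∧ Odd (y i)) ∧ n = ∑ i, c i * y i ^ 2}

/-- `NstRep v k b c n` is the number of pairs of tuples `((y₁, …, y_v), (z₁, …, z_k))`
with the `yᵢ` integers and the `z_j` nonnegative integers such that
`n = Σᵢ bᵢ·yᵢ² + Σⱼ cⱼ·zⱼ(zⱼ+1)/2`. -/
noncomputable def NstRep (v k : ℕ) (b : Fin v → ℕ) (c : Fin k → ℕ) (n : ℕ) : ℕ :=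
  Set.ncard {p : (Fin v → ℤ) × (Fin k → ℕ) |
    (n : ℤ) = ∑ i, (b i : ℤ) * p.1 i ^ 2 +
      ∑ j, (c j : ℤ) * ((p.2 j * (p.2 j + 1) / 2 : ℕ) : ℤ)}

/-- The finite set of pairs `(a, b)` of nonnegative integers with `a + 2b = n`. -/
def convPairs (n : ℕ) : Finset (ℕ × ℕ) :=
  (Finset.range (n + 1) ×ˢ Finset.range (n + 1)).filter fun p => p.1 + 2 * p.2 = n

/-- The quadratic character mod 8: `χ₈(m) = 1` if `m ≡ ±1 (mod 8)`, `-1` if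
`m ≡ ±3 (mod 8)`, `0` if `m` is even. -/
def chi8 (m : ℤ) : ℤ :=
  if m % 8 = 1 ∨ m % 8 = 7 then 1 else if m % 8 = 3 ∨ m % 8 = 5 then -1 else 0

/-- The integer pairs `(x, y)` with `x² + D y² = n`. -/
noncomputable def normPairs (D : ℤ) (n : ℕ) : Finset (ℤ × ℤ) :=
  (Finset.Icc (-n : ℤ) n ×ˢ Finset.Icc (-n : ℤ) n).filter fun z => z.1 ^ 2 + D * z.2 ^ 2 = n

theorem mem_normPairs {D : ℤ} (hD : 1 ≤ D) {n : ℕ} {z : ℤ × ℤ} :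
    z ∈ normPairs D n ↔ z.1 ^ 2 + D * z.2 ^ 2 = n := by
  simp only [normPairs, Finset.mem_filter, Finset.mem_product, Finset.mem_Icc,
    and_iff_right_iff_imp]
  intro h
  have hx : |z.1| ≤ n := by
    rw [← sq_abs z.1] at h
    have := abs_nonneg z.1
    nlinarith [mul_nonneg (by linarith : (0 : ℤ) ≤ D) (sq_nonneg z.2), Int.le_self_sq |z.1|]
  have hy : |z.2| ≤ n := by
    rw [← sq_abs z.2] at h
    have := abs_nonneg z.2
    nlinarith [mul_nonneg (by linarith : (0 : ℤ) ≤ D - 1) (sq_nonneg |z.2|), sq_nonneg z.1,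
      Int.le_self_sq |z.2|]
  exact ⟨abs_le.mp hx, abs_le.mp hy⟩

/-- Multiplication by `u + v √(-D)` on coordinates. -/
def normMul (D u v : ℤ) (z : ℤ × ℤ) : ℤ × ℤ :=
  (u * z.1 - D * v * z.2, u * z.2 + v * z.1)

theorem normMul_injective {D u v : ℤ} (h : u ^ 2 + D * v ^ 2 ≠ 0) :
    Function.Injective (normMul D u v) := by
  rintro ⟨x, y⟩ ⟨x', y'⟩ hz
  simp only [normMul, Prod.mk.injEq] at hz
  obtain ⟨h1, h2⟩ := hz
  refine Prod.ext (mul_left_cancel₀ h ?_) (mul_left_cancel₀ h ?_)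
  · linear_combination u * h1 + D * v * h2
  · linear_combination u * h2 - v * h1

theorem mem_image_normMul {D : ℤ} (hD : 1 ≤ D) {p n : ℕ} (hp : p.Prime) {u v : ℤ}
    (huv : u ^ 2 + D * v ^ 2 = p) {z : ℤ × ℤ} :
    z ∈ (normPairs D n).image (normMul D u v) ↔
      z ∈ normPairs D (p * n) ∧ (p : ℤ) ∣ u * z.2 - v * z.1 := by
  have hp0 : (p : ℤ) ≠ 0 := by exact_mod_cast hp.ne_zero
  obtain ⟨x, y⟩ := z
  simp only [Finset.mem_image, mem_normPairs hD, Prod.exists, normMul, Prod.mk.injEq]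
  push_cast
  constructor
  · rintro ⟨a, b, hab, rfl, rfl⟩
    refine ⟨by rw [← hab, ← huv]; ring, b, ?_⟩
    rw [← huv]; ring
  · rintro ⟨hxy, t, ht⟩
    have hs : (p : ℤ) ∣ u * x + D * v * y := by
      refine (Nat.prime_iff_prime_int.mp hp).dvd_of_dvd_pow (n := 2) ⟨p * n - D * p * t ^ 2, ?_⟩
      linear_combination (u ^ 2 + D * v ^ 2) * hxy + p * n * huv
        - D * (u * y - v * x + p * t) * ht
    obtain ⟨s, hs⟩ := hs
    refine ⟨s, t, ?_, ?_, ?_⟩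
    · refine mul_left_cancel₀ (pow_ne_zero 2 hp0) ?_
      linear_combination (u ^ 2 + D * v ^ 2) * hxy + p * n * huv
        - D * (u * y - v * x + p * t) * ht - (u * x + D * v * y + p * s) * hs
    · refine mul_left_cancel₀ hp0 ?_
      linear_combination x * huv - u * hs + D * v * ht
    · refine mul_left_cancel₀ hp0 ?_
      linear_combination y * huv - u * ht - v * hs

theorem card_filter_dvd_normPairs {D : ℤ} (hD : 1 ≤ D) {p : ℕ} (hp : p.Prime) (n : ℕ) :
    ((normPairs D (p * n)).filter fun z => (p : ℤ) ∣ z.1 ∧ (p : ℤ) ∣ z.2).card =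
      if p ∣ n then (normPairs D (n / p)).card else 0 := by
  have hp0 : (p : ℤ) ≠ 0 := by exact_mod_cast hp.ne_zero
  split_ifs with hn
  · obtain ⟨m, rfl⟩ := hn
    rw [Nat.mul_div_cancel_left _ hp.pos]
    symm
    refine Finset.card_bij (fun z _ => (p * z.1, p * z.2)) ?_ ?_ ?_
    · rintro ⟨x, y⟩ h
      rw [mem_normPairs hD] at h
      simp only [Finset.mem_filter, mem_normPairs hD, dvd_mul_right, and_true]
      push_cast
      rw [← h]; ring
    · rintro ⟨x, y⟩ _ ⟨x', y'⟩ _ h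
      simpa [hp.ne_zero] using h
    · rintro ⟨x, y⟩ h
      simp only [Finset.mem_filter, mem_normPairs hD] at h
      obtain ⟨h, ⟨a, rfl⟩, ⟨b, rfl⟩⟩ := h
      refine ⟨(a, b), ?_, rfl⟩
      rw [mem_normPairs hD]
      refine mul_left_cancel₀ (pow_ne_zero 2 hp0) ?_
      push_cast at h
      linear_combination h
  · rw [Finset.card_eq_zero, Finset.filter_eq_empty_iff]
    rintro ⟨x, y⟩ h ⟨⟨a, ha⟩, ⟨b, hb⟩⟩
    simp only at ha hb
    subst ha hb
    rw [mem_normPairs hD] at h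
    apply hn
    have : (p : ℤ) ∣ n := by
      refine ⟨a ^ 2 + D * b ^ 2, mul_left_cancel₀ hp0 ?_⟩
      push_cast at h
      linear_combination -h
    exact_mod_cast this

theorem card_normPairs_of_inert {D : ℤ} (hD : 1 ≤ D) {p : ℕ} (hp : p.Prime)
    (hinert : ∀ x y : ℤ, (p : ℤ) ∣ x ^ 2 + D * y ^ 2 → (p : ℤ) ∣ x ∧ (p : ℤ) ∣ y) (n : ℕ) :
    (normPairs D (p * n)).card = if p ∣ n then (normPairs D (n / p)).card else 0 := by
  rw [← card_filter_dvd_normPairs hD hp, Finset.filter_true_of_mem]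
  rintro ⟨x, y⟩ h
  rw [mem_normPairs hD] at h
  exact hinert x y ⟨n, by push_cast at h; exact h⟩

theorem card_normPairs_of_split {D : ℤ} (hD : 1 ≤ D) {p : ℕ} (hp : p.Prime) (hp2 : p ≠ 2)
    (hpD : ¬ (p : ℤ) ∣ D) {u v : ℤ} (huv : u ^ 2 + D * v ^ 2 = p) (n : ℕ) :
    (normPairs D (p * n)).card + (if p ∣ n then (normPairs D (n / p)).card else 0) =
      2 * (normPairs D n).card := by
  have hpi := Nat.prime_iff_prime_int.mp hp
  have huv' : u ^ 2 + D * (-v) ^ 2 = p := by rw [neg_sq, huv]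
  have hne : (p : ℤ) ≠ 0 := hpi.ne_zero
  have hp2' : ¬ (p : ℤ) ∣ 2 := by
    intro h
    have h' : p ∣ 2 := by exact_mod_cast h
    exact hp2 ((Nat.prime_dvd_prime_iff_eq hp Nat.prime_two).mp h')
  have hu : ¬ (p : ℤ) ∣ u := by
    rintro ⟨a, rfl⟩
    have hv : (p : ℤ) ∣ v := by
      have : (p : ℤ) ∣ D * v ^ 2 := ⟨1 - p * a ^ 2, by linear_combination huv⟩
      exact hpi.dvd_of_dvd_pow ((hpi.dvd_or_dvd this).resolve_left hpD)
    obtain ⟨b, rfl⟩ := hv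
    have : (p : ℤ) ∣ 1 := by
      refine ⟨a ^ 2 + D * b ^ 2, mul_left_cancel₀ hne ?_⟩
      linear_combination -huv
    exact hpi.not_isUnit (isUnit_of_dvd_one this)
  have hunion : normPairs D (p * n) = (normPairs D n).image (normMul D u v) ∪
      (normPairs D n).image (normMul D u (-v)) := by
    ext ⟨x, y⟩
    rw [Finset.mem_union, mem_image_normMul hD hp huv, mem_image_normMul hD hp huv',
      ← and_or_left, iff_self_and, mem_normPairs hD]
    intro h
    apply hpi.dvd_or_dvd
    push_cast at h
    refine ⟨y ^ 2 - v ^ 2 * n, ?_⟩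
    simp only at h ⊢
    linear_combination y ^ 2 * huv - v ^ 2 * h
  have hinter : (normPairs D n).image (normMul D u v) ∩
      (normPairs D n).image (normMul D u (-v)) =
      (normPairs D (p * n)).filter fun z => (p : ℤ) ∣ z.1 ∧ (p : ℤ) ∣ z.2 := by
    ext ⟨x, y⟩
    rw [Finset.mem_inter, mem_image_normMul hD hp huv, mem_image_normMul hD hp huv',
      Finset.mem_filter, ← and_and_left]
    refine and_congr_right fun h => ⟨?_, ?_⟩
    · rintro ⟨h1, h2⟩
      simp only at h1 h2 ⊢
      have hy : (p : ℤ) ∣ y := by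
        have : (p : ℤ) ∣ (2 * u) * y := by
          rw [show 2 * u * y = (u * y - v * x) + (u * y - -v * x) by ring]
          exact dvd_add h1 h2
        rcases hpi.dvd_or_dvd this with h | h
        · rcases hpi.dvd_or_dvd h with h | h
          · exact absurd h hp2'
          · exact absurd h hu
        · exact h
      refine ⟨?_, hy⟩
      rw [mem_normPairs hD] at h
      obtain ⟨b, rfl⟩ := hy
      refine hpi.dvd_of_dvd_pow (n := 2) ⟨n - D * p * b ^ 2, ?_⟩
      push_cast at h
      linear_combination h
    · rintro ⟨h1, h2⟩
      exact ⟨dvd_sub (h2.mul_left _) (h1.mul_left _), dvd_sub (h2.mul_left _) (h1.mul_left _)⟩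
  rw [← card_filter_dvd_normPairs hD hp, ← hinter, hunion, Finset.card_union_add_card_inter,
    Finset.card_image_of_injective _ (normMul_injective (by rw [huv]; exact hne)),
    Finset.card_image_of_injective _ (normMul_injective (by rw [huv']; exact hne)), two_mul]

theorem sum_divisors_prime_mul (χ : ℕ → ℤ) (hχ : ∀ a b, χ (a * b) = χ a * χ b) {p n : ℕ}
    (hp : p.Prime) (hn : n ≠ 0) :
    ∑ d ∈ (p * n).divisors, χ d + χ p * (if p ∣ n then ∑ d ∈ (n / p).divisors, χ d else 0) =
      (1 + χ p) * ∑ d ∈ n.divisors, χ d := by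
  have hdvd : ∀ m, m ≠ 0 → ∑ d ∈ (p * m).divisors with p ∣ d, χ d =
      χ p * ∑ d ∈ m.divisors, χ d := by
    intro m hm
    rw [Finset.mul_sum]
    symm
    refine Finset.sum_bij (fun d _ => p * d) ?_ ?_ ?_ ?_
    · intro d hd
      simp only [Nat.mem_divisors, Finset.mem_filter] at hd ⊢
      exact ⟨⟨mul_dvd_mul_left p hd.1, mul_ne_zero hp.ne_zero hm⟩, dvd_mul_right _ _⟩
    · intro a _ b _ h
      exact Nat.eq_of_mul_eq_mul_left hp.pos h
    · intro d hd
      simp only [Nat.mem_divisors, Finset.mem_filter] at hd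
      obtain ⟨⟨h1, -⟩, e, rfl⟩ := hd
      exact ⟨e, Nat.mem_divisors.mpr ⟨Nat.dvd_of_mul_dvd_mul_left hp.pos h1, hm⟩, rfl⟩
    · intro d _
      rw [hχ]
  have hcop : (p * n).divisors.filter (fun d => ¬ p ∣ d) = n.divisors.filter fun d => ¬ p ∣ d := by
    ext d
    simp only [Nat.mem_divisors, Finset.mem_filter, ne_eq, mul_eq_zero, hp.ne_zero, hn, or_self,
      not_false_eq_true, and_true]
    refine and_congr_left fun hd => ⟨fun h => ?_, fun h => h.mul_left p⟩
    exact ((hp.coprime_iff_not_dvd.mpr hd).symm.dvd_of_dvd_mul_left h)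
  have hn' : ∑ d ∈ n.divisors with p ∣ d, χ d =
      χ p * (if p ∣ n then ∑ d ∈ (n / p).divisors, χ d else 0) := by
    split_ifs with h
    · obtain ⟨m, rfl⟩ := h
      rw [Nat.mul_div_cancel_left _ hp.pos, hdvd m (right_ne_zero_of_mul hn)]
    · rw [mul_zero]
      refine Finset.sum_eq_zero fun d hd => ?_
      rw [Finset.mem_filter, Nat.mem_divisors] at hd
      exact absurd (hd.2.trans hd.1.1) h
  have e1 := Finset.sum_filter_add_sum_filter_not (p * n).divisors (fun d => p ∣ d) χ
  have e2 := Finset.sum_filter_add_sum_filter_not n.divisors (fun d => p ∣ d) χ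
  rw [hdvd n hn, hcop] at e1
  rw [hn'] at e2
  linear_combination -e1 + e2

/-- If every odd prime is either represented by `x² + D y²` or inert, as recorded by a completely
multiplicative `χ`, then an odd `n` has `2 ∑_{d ∣ n} χ d` representations by `x² + D y²`. Both sides
satisfy the same recursion in `n ↦ p n`. -/
theorem card_normPairs_eq_two_mul_sum {D : ℤ} (hD : 2 ≤ D) (χ : ℕ → ℤ) (hχ1 : χ 1 = 1)
    (hχ : ∀ a b, χ (a * b) = χ a * χ b)
    (hprime : ∀ p : ℕ, p.Prime → p ≠ 2 → ¬ (p : ℤ) ∣ D ∧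
      ((χ p = 1 ∧ ∃ u v : ℤ, u ^ 2 + D * v ^ 2 = p) ∨
        (χ p = -1 ∧ ∀ x y : ℤ, (p : ℤ) ∣ x ^ 2 + D * y ^ 2 → (p : ℤ) ∣ x ∧ (p : ℤ) ∣ y)))
    {n : ℕ} (hn : Odd n) :
    ((normPairs D n).card : ℤ) = 2 * ∑ d ∈ n.divisors, χ d := by
  have hD1 : 1 ≤ D := by linarith
  induction n using Nat.strong_induction_on with
  | _ n ih =>
  by_cases h1 : n = 1
  · subst h1
    have : normPairs D 1 = {(1, 0), (-1, 0)} := by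
      ext ⟨x, y⟩
      simp only [mem_normPairs hD1, Finset.mem_insert, Finset.mem_singleton, Prod.mk.injEq]
      push_cast
      constructor
      · intro h
        have hy : y = 0 := by
          by_contra hy
          have : 1 ≤ y ^ 2 := by have := sq_pos_of_ne_zero hy; omega
          nlinarith [sq_nonneg x]
        subst hy
        have : x = 1 ∨ x = -1 := sq_eq_one_iff.mp (by linarith)
        tauto
      · rintro (⟨rfl, rfl⟩ | ⟨rfl, rfl⟩) <;> norm_num
    rw [this]
    simp [hχ1]
  · obtain ⟨p, hp, m, rfl⟩ := Nat.exists_prime_and_dvd h1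
    have hpo : Odd p := (Nat.odd_mul.mp hn).1
    have hmo : Odd m := (Nat.odd_mul.mp hn).2
    have hm0 : 0 < m := hmo.pos
    have hp2 : p ≠ 2 := by rintro rfl; exact absurd hpo (by decide)
    have ihm := ih m (by nlinarith [hp.two_le]) hmo
    have ihd : ((if p ∣ m then (normPairs D (m / p)).card else 0 : ℕ) : ℤ) =
        2 * (if p ∣ m then ∑ d ∈ (m / p).divisors, χ d else 0) := by
      split_ifs with h
      · obtain ⟨k, rfl⟩ := h
        rw [Nat.mul_div_cancel_left _ hp.pos]
        exact ih k
          (by nlinarith [hp.two_le, Nat.pos_of_mul_pos_left hm0, mul_pos hp.pos hp.pos])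
          (Nat.odd_mul.mp hmo).2
      · simp
    have hrec := sum_divisors_prime_mul χ hχ hp hm0.ne'
    obtain ⟨hpD, ⟨hc, u, v, huv⟩ | ⟨hc, hin⟩⟩ := hprime p hp hp2
    · have := card_normPairs_of_split hD1 hp hp2 hpD huv m
      have : ((normPairs D (p * m)).card : ℤ) +
        ((if p ∣ m then (normPairs D (m / p)).card else 0 : ℕ) : ℤ) = 2 * (normPairs D m).card := by
        exact_mod_cast this
      rw [ihd, ihm] at this
      rw [hc] at hrec
      linear_combination this - 2 * hrec
    · have := card_normPairs_of_inert hD1 hp hin m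
      rw [this, ihd]
      rw [hc] at hrec
      linear_combination -2 * hrec

theorem exists_sq_add_two_mul_sq {p : ℕ} (hp : p.Prime) (hp2 : p ≠ 2)
    (h : p % 8 = 1 ∨ p % 8 = 3) : ∃ u v : ℤ, u ^ 2 + 2 * v ^ 2 = p := by
  have := Fact.mk hp
  obtain ⟨s, hs⟩ := (ZMod.exists_sq_eq_neg_two_iff hp2).mpr h
  set k := Nat.sqrt p with hk
  have hk1 : p < (k + 1) * (k + 1) := Nat.lt_succ_sqrt p
  have hk2 : k * k < p := by
    refine lt_of_le_of_ne (Nat.sqrt_le p) fun he => ?_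
    exact (Nat.prime_iff_prime_int.mp hp).irreducible.not_isSquare ⟨k, by exact_mod_cast he.symm⟩
  obtain ⟨⟨a, b⟩, hab, ⟨a', b'⟩, hab', hne, heq⟩ :=
    Finset.exists_ne_map_eq_of_card_lt_of_maps_to
      (s := Finset.range (k + 1) ×ˢ Finset.range (k + 1)) (t := (Finset.univ : Finset (ZMod p)))
      (by simpa [ZMod.card] using hk1) (f := fun z => (z.1 : ZMod p) - s * z.2)
      (fun _ _ => Finset.mem_coe.mpr (Finset.mem_univ _))
  simp only [Finset.mem_product, Finset.mem_range] at hab hab' heq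
  set x : ℤ := a - a' with hx
  set y : ℤ := b - b' with hy
  have hdvd : (p : ℤ) ∣ x ^ 2 + 2 * y ^ 2 := by
    rw [← ZMod.intCast_zmod_eq_zero_iff_dvd]
    rw [hx, hy]
    push_cast
    have e : (a : ZMod p) - a' = s * (b - b') := by linear_combination heq
    rw [e]
    linear_combination -((b : ZMod p) - b') ^ 2 * hs
  have hxk : x ^ 2 ≤ k * k := by
    rw [← sq]; exact sq_le_sq' (by omega) (by omega)
  have hyk : y ^ 2 ≤ k * k := by
    rw [← sq]; exact sq_le_sq' (by omega) (by omega)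
  have hkp : (k * k : ℤ) < p := by exact_mod_cast hk2
  have hpos : 0 < x ^ 2 + 2 * y ^ 2 := by
    by_contra hcon
    have h1 : x ^ 2 = 0 := by nlinarith [sq_nonneg x, sq_nonneg y]
    have h2 : y ^ 2 = 0 := by nlinarith [sq_nonneg x, sq_nonneg y]
    rw [sq_eq_zero_iff] at h1 h2
    apply hne
    ext <;> simp only <;> omega
  obtain ⟨t, ht⟩ := hdvd
  have hp0 : (0 : ℤ) < p := by exact_mod_cast hp.pos
  have ht0 : 0 < t := by
    by_contra hcon
    nlinarith
  have ht3 : t < 3 := by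
    by_contra hcon
    nlinarith
  interval_cases t
  · exact ⟨x, y, by linarith⟩
  · have hev : Even (x ^ 2) := ⟨p - y ^ 2, by linarith⟩
    obtain ⟨w, hw⟩ := (Int.even_pow.mp hev).1
    refine ⟨y, w, ?_⟩
    rw [hw] at ht
    nlinarith

theorem exists_sq_add_four_mul_sq {p : ℕ} (hp : p.Prime) (h : p % 4 = 1) :
    ∃ u v : ℤ, u ^ 2 + 4 * v ^ 2 = p := by
  have := Fact.mk hp
  obtain ⟨a, b, hab⟩ := Nat.Prime.sq_add_sq (p := p) (by omega)
  have hab' : (a : ℤ) ^ 2 + (b : ℤ) ^ 2 = p := by exact_mod_cast hab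
  rcases Nat.even_or_odd' a with ⟨c, rfl | rfl⟩
  · exact ⟨b, c, by rw [← hab']; push_cast; ring⟩
  · rcases Nat.even_or_odd' b with ⟨d, rfl | rfl⟩
    · exact ⟨(2 * c + 1 : ℕ), d, by rw [← hab']; push_cast; ring⟩
    · ring_nf at hab
      omega

theorem isSquare_neg_of_dvd_sq_add_mul_sq {p : ℕ} [Fact p.Prime] {D x y : ℤ}
    (h : (p : ℤ) ∣ x ^ 2 + D * y ^ 2) (hy : ¬ (p : ℤ) ∣ y) : IsSquare (-(D : ZMod p)) := by
  rw [← ZMod.intCast_zmod_eq_zero_iff_dvd] at h hy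
  push_cast at h
  refine ⟨x / y, ?_⟩
  field_simp
  linear_combination -h

theorem dvd_and_dvd_of_not_isSquare {p : ℕ} (hp : p.Prime) {D : ℤ}
    (hD : ¬ IsSquare (-(D : ZMod p))) (x y : ℤ) (h : (p : ℤ) ∣ x ^ 2 + D * y ^ 2) :
    (p : ℤ) ∣ x ∧ (p : ℤ) ∣ y := by
  have := Fact.mk hp
  have hy : (p : ℤ) ∣ y := by
    by_contra hy
    exact hD (isSquare_neg_of_dvd_sq_add_mul_sq h hy)
  refine ⟨(Nat.prime_iff_prime_int.mp hp).dvd_of_dvd_pow (n := 2) ?_, hy⟩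
  have : (p : ℤ) ∣ D * y ^ 2 := (dvd_pow hy two_ne_zero).mul_left D
  exact (dvd_add_left this).mp h

theorem card_normPairs_two {n : ℕ} (hn : Odd n) :
    ((normPairs 2 n).card : ℤ) = 2 * ∑ d ∈ n.divisors, ZMod.χ₈' (d : ZMod 8) := by
  refine card_normPairs_eq_two_mul_sum le_rfl (fun m => ZMod.χ₈' (m : ZMod 8)) (by simp)
    (fun a b => by rw [Nat.cast_mul, map_mul]) ?_ hn
  intro p hp hp2
  have := Fact.mk hp
  have hodd : p % 2 = 1 := (hp.eq_two_or_odd).resolve_left hp2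
  refine ⟨fun h => hp2 ((Nat.prime_dvd_prime_iff_eq hp Nat.prime_two).mp (by exact_mod_cast h)), ?_⟩
  by_cases h : p % 8 = 1 ∨ p % 8 = 3
  · left
    refine ⟨?_, exists_sq_add_two_mul_sq hp hp2 h⟩
    simp only [ZMod.χ₈'_nat_eq_if_mod_eight]
    simp [hodd, h]
  · right
    refine ⟨?_, dvd_and_dvd_of_not_isSquare hp ?_⟩
    · simp only [ZMod.χ₈'_nat_eq_if_mod_eight]
      simp [hodd, h]
    · rw [← ZMod.exists_sq_eq_neg_two_iff hp2] at h
      simpa using h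

theorem card_normPairs_four {n : ℕ} (hn : Odd n) :
    ((normPairs 4 n).card : ℤ) = 2 * ∑ d ∈ n.divisors, ZMod.χ₄ (d : ZMod 4) := by
  refine card_normPairs_eq_two_mul_sum (by norm_num) (fun m => ZMod.χ₄ (m : ZMod 4)) (by simp)
    (fun a b => by rw [Nat.cast_mul, map_mul]) ?_ hn
  intro p hp hp2
  have := Fact.mk hp
  have hodd : p % 2 = 1 := (hp.eq_two_or_odd).resolve_left hp2
  have h2 : ¬ (p : ℤ) ∣ 2 := fun h =>
    hp2 ((Nat.prime_dvd_prime_iff_eq hp Nat.prime_two).mp (by exact_mod_cast h))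
  refine ⟨fun h => h2 ((Nat.prime_iff_prime_int.mp hp).dvd_of_dvd_pow (n := 2) (by simpa using h)),
    ?_⟩
  have h4 : p % 4 = 1 ∨ p % 4 = 3 := by omega
  rcases h4 with h | h
  · exact Or.inl ⟨ZMod.χ₄_nat_one_mod_four h, exists_sq_add_four_mul_sq hp h⟩
  · refine Or.inr ⟨ZMod.χ₄_nat_three_mod_four h, dvd_and_dvd_of_not_isSquare hp ?_⟩
    rintro ⟨s, hs⟩
    have h2' : (2 : ZMod p) ≠ 0 := by
      have := mt (ZMod.intCast_zmod_eq_zero_iff_dvd 2 p).mp h2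
      simpa using this
    refine ZMod.mod_four_ne_three_of_sq_eq_neg_sq' (p := p) h2' (x := s) ?_ h
    push_cast at hs
    linear_combination -hs

/-- The pairs of odd natural numbers `(x, y)` with `x² + c y² = k`. -/
def oddPairs (c k : ℕ) : Finset (ℕ × ℕ) :=
  (Finset.range (k + 1) ×ˢ Finset.range (k + 1)).filter fun z =>
    (z.1 % 2 = 1 ∧ z.2 % 2 = 1) ∧ z.1 ^ 2 + c * z.2 ^ 2 = k

theorem mem_oddPairs {c : ℕ} (hc : 0 < c) {k : ℕ} {z : ℕ × ℕ} :
    z ∈ oddPairs c k ↔ (z.1 % 2 = 1 ∧ z.2 % 2 = 1) ∧ z.1 ^ 2 + c * z.2 ^ 2 = k := by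
  simp only [oddPairs, Finset.mem_filter, Finset.mem_product, Finset.mem_range,
    and_iff_right_iff_imp]
  rintro ⟨-, h⟩
  constructor <;> nlinarith [Nat.zero_le (c * z.2 ^ 2), Nat.zero_le (z.1 ^ 2),
    Nat.le_self_pow two_ne_zero z.1, Nat.le_self_pow two_ne_zero z.2]

theorem card_normPairs_eq_four_mul {c k : ℕ} (hc : 0 < c)
    (hodd : ∀ x y : ℤ, x ^ 2 + c * y ^ 2 = k → x % 2 = 1 ∧ y % 2 = 1) :
    (normPairs c k).card = 4 * (oddPairs c k).card := by
  have hc' : (1 : ℤ) ≤ c := by exact_mod_cast hc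
  rw [mul_comm, ← smul_eq_mul, ← Finset.sum_const]
  rw [Finset.card_eq_sum_card_fiberwise (f := fun z : ℤ × ℤ => (z.1.natAbs, z.2.natAbs))
    (t := oddPairs c k)]
  · refine Finset.sum_congr rfl ?_
    rintro ⟨a, b⟩ h
    rw [mem_oddPairs hc] at h
    obtain ⟨⟨ha, hb⟩, h⟩ := h
    simp only at ha hb h
    have h' : (a : ℤ) ^ 2 + c * (b : ℤ) ^ 2 = k := by exact_mod_cast h
    have : (normPairs c k).filter (fun z : ℤ × ℤ => (z.1.natAbs, z.2.natAbs) = (a, b)) =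
        ({(a : ℤ), -(a : ℤ)} : Finset ℤ) ×ˢ ({(b : ℤ), -(b : ℤ)} : Finset ℤ) := by
      ext ⟨x, y⟩
      simp only [Finset.mem_filter, mem_normPairs hc', Prod.mk.injEq, Finset.mem_product,
        Finset.mem_insert, Finset.mem_singleton, Int.natAbs_eq_iff]
      refine ⟨fun h => h.2, fun hxy => ⟨?_, hxy⟩⟩
      rcases hxy with ⟨rfl | rfl, rfl | rfl⟩ <;> simpa using h'
    rw [this, Finset.card_product, Finset.card_pair (by omega), Finset.card_pair (by omega)]
  · rintro ⟨x, y⟩ h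
    rw [Finset.mem_coe, mem_normPairs hc'] at h
    rw [Finset.mem_coe, mem_oddPairs hc]
    have := hodd x y h
    refine ⟨⟨by simp only; omega, by simp only; omega⟩, ?_⟩
    zify
    simpa using h

/-- The factorisations `k = x y` with `x ≡ α` and `y ≡ β` modulo `8`. -/
def factorPairs (α β k : ℕ) : Finset (ℕ × ℕ) :=
  k.divisorsAntidiagonal.filter fun z => z.1 % 8 = α ∧ z.2 % 8 = β

theorem card_factorPairs_comm (α β k : ℕ) :
    (factorPairs α β k).card = (factorPairs β α k).card := by
  refine Finset.card_bij' (fun z _ => z.swap) (fun z _ => z.swap) ?_ ?_ ?_ ?_ <;>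
  simp +contextual [factorPairs]

theorem factorPairs_eq_empty {α β k : ℕ} (h : k % 8 ≠ α * β % 8) : factorPairs α β k = ∅ := by
  refine Finset.filter_eq_empty_iff.mpr ?_
  rintro ⟨d, d'⟩ hd ⟨h1, h2⟩
  rw [Nat.mem_divisorsAntidiagonal] at hd
  simp only at h1 h2 hd
  rw [← hd.1, Nat.mul_mod, h1, h2] at h
  exact h rfl

theorem sum_divisors_eq_card_factorPairs (χ : ℕ → ℤ) {k α β γ δ : ℕ}
    (h : ∀ a b : ℕ, a * b = k → χ a =
      (if a % 8 = α ∧ b % 8 = β then 1 else 0) + (if a % 8 = β ∧ b % 8 = α then 1 else 0) -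
      ((if a % 8 = γ ∧ b % 8 = δ then 1 else 0) + (if a % 8 = δ ∧ b % 8 = γ then 1 else 0))) :
    ∑ d ∈ k.divisors, χ d =
      2 * ((factorPairs α β k).card - (factorPairs γ δ k).card) := by
  rw [← Nat.sum_divisorsAntidiagonal (fun i _ => χ i)]
  rw [Finset.sum_congr rfl fun z hz => h z.1 z.2 (Nat.mem_divisorsAntidiagonal.mp hz).1]
  rw [Finset.sum_sub_distrib, Finset.sum_add_distrib, Finset.sum_add_distrib]
  have e (a b : ℕ) : ∑ z ∈ k.divisorsAntidiagonal,
      (if z.1 % 8 = a ∧ z.2 % 8 = b then (1 : ℤ) else 0) = (factorPairs a b k).card := by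
    rw [Finset.sum_boole]; rfl
  rw [e, e, e, e, card_factorPairs_comm β α, card_factorPairs_comm δ γ]
  ring

theorem Int.sq_emod_eight (x : ℤ) :
    x % 2 = 1 ∧ x ^ 2 % 8 = 1 ∨ x % 2 = 0 ∧ (x ^ 2 % 8 = 0 ∨ x ^ 2 % 8 = 4) := by
  have h : x % 8 = 0 ∨ x % 8 = 1 ∨ x % 8 = 2 ∨ x % 8 = 3 ∨ x % 8 = 4 ∨ x % 8 = 5 ∨ x % 8 = 6 ∨
    x % 8 = 7 := by omega
  rcases h with h | h | h | h | h | h | h | h <;> simp [sq, Int.mul_emod, h] <;> omega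

theorem Nat.sq_mod_eight_of_odd {x : ℕ} (hx : x % 2 = 1) : x ^ 2 % 8 = 1 := by
  have := Int.sq_emod_eight x
  zify at hx ⊢
  omega

theorem card_oddPairs_two (k : ℕ) :
    ((oddPairs 2 k).card : ℤ) = (factorPairs 3 1 k).card - (factorPairs 5 7 k).card := by
  by_cases hk : k % 8 = 3
  · have h1 := card_normPairs_eq_four_mul (c := 2) (k := k) two_pos (by
      intro x y h
      have hx := Int.sq_emod_eight x
      have hy := Int.sq_emod_eight y
      push_cast at h
      omega)
    have h2 := card_normPairs_two (n := k) (Nat.odd_iff.mpr (by omega))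
    rw [sum_divisors_eq_card_factorPairs (α := 3) (β := 1) (γ := 5) (δ := 7)
      (fun d => ZMod.χ₈' (d : ZMod 8))] at h2
    · push_cast at h1
      rw [h1] at h2
      push_cast at h2
      linarith
    · intro a b hab
      have hab' : a % 8 * (b % 8) % 8 = 3 := by rw [← Nat.mul_mod, hab, hk]
      simp only [ZMod.χ₈'_nat_eq_if_mod_eight]
      have ha : a % 2 = a % 8 % 2 := by omega
      rw [ha]
      have h1 : a % 8 < 8 := Nat.mod_lt _ (by norm_num)
      have h2 : b % 8 < 8 := Nat.mod_lt _ (by norm_num)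
      revert hab'
      generalize a % 8 = r at *
      generalize b % 8 = s at *
      clear ha hab
      interval_cases r <;> interval_cases s <;> simp
  · rw [factorPairs_eq_empty (by omega), factorPairs_eq_empty (by omega)]
    have : oddPairs 2 k = ∅ := by
      refine Finset.eq_empty_of_forall_notMem fun z hz => hk ?_
      rw [mem_oddPairs two_pos] at hz
      have h1 := Nat.sq_mod_eight_of_odd hz.1.1
      have h2 := Nat.sq_mod_eight_of_odd hz.1.2
      omega
    simp [this]

theorem card_oddPairs_four (k : ℕ) :
    ((oddPairs 4 k).card : ℤ) = (factorPairs 5 1 k).card - (factorPairs 3 7 k).card := by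
  by_cases hk : k % 8 = 5
  · have h1 := card_normPairs_eq_four_mul (c := 4) (k := k) four_pos (by
      intro x y h
      have hx := Int.sq_emod_eight x
      have hy := Int.sq_emod_eight y
      push_cast at h
      omega)
    have h2 := card_normPairs_four (n := k) (Nat.odd_iff.mpr (by omega))
    rw [sum_divisors_eq_card_factorPairs (α := 5) (β := 1) (γ := 3) (δ := 7)
      (fun d => ZMod.χ₄ (d : ZMod 4))] at h2
    · push_cast at h1
      rw [h1] at h2
      push_cast at h2
      linarith
    · intro a b hab
      have hab' : a % 8 * (b % 8) % 8 = 5 := by rw [← Nat.mul_mod, hab, hk]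
      simp only [ZMod.χ₄_nat_eq_if_mod_four]
      have ha : a % 2 = a % 8 % 2 := by omega
      have ha' : a % 4 = a % 8 % 4 := by omega
      rw [ha, ha']
      have h1 : a % 8 < 8 := Nat.mod_lt _ (by norm_num)
      have h2 : b % 8 < 8 := Nat.mod_lt _ (by norm_num)
      revert hab'
      generalize a % 8 = r at *
      generalize b % 8 = s at *
      clear ha ha' hab
      interval_cases r <;> interval_cases s <;> simp
  · rw [factorPairs_eq_empty (by omega), factorPairs_eq_empty (by omega)]
    have : oddPairs 4 k = ∅ := by
      refine Finset.eq_empty_of_forall_notMem fun z hz => hk ?_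
      rw [mem_oddPairs four_pos] at hz
      have h1 := Nat.sq_mod_eight_of_odd hz.1.1
      have h2 := Nat.sq_mod_eight_of_odd hz.1.2
      omega
    simp [this]

/-- The pairs of an element of `F k` and an element of `G l`, over all `k + l = N`. -/
def additivePairs (F G : ℕ → Finset (ℕ × ℕ)) (N : ℕ) : Finset ((ℕ × ℕ) × (ℕ × ℕ)) :=
  (Finset.HasAntidiagonal.antidiagonal N).biUnion fun z => F z.1 ×ˢ G z.2

theorem mem_additivePairs {F G : ℕ → Finset (ℕ × ℕ)} {N : ℕ} {w : (ℕ × ℕ) × (ℕ × ℕ)} :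
    w ∈ additivePairs F G N ↔ ∃ k l, k + l = N ∧ w.1 ∈ F k ∧ w.2 ∈ G l := by
  simp [additivePairs]

theorem card_additivePairs {F G : ℕ → Finset (ℕ × ℕ)}
    (hF : ∀ k k' z, z ∈ F k → z ∈ F k' → k = k') (N : ℕ) :
    (additivePairs F G N).card =
      ∑ z ∈ Finset.HasAntidiagonal.antidiagonal N, (F z.1).card * (G z.2).card := by
  rw [additivePairs, Finset.card_biUnion]
  · simp
  · rintro ⟨k, l⟩ hz ⟨k', l'⟩ hz' hne
    rw [Function.onFun, Finset.disjoint_left]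
    rintro w hw hw'
    rw [Finset.mem_product] at hw hw'
    simp only [Finset.mem_coe, Finset.HasAntidiagonal.mem_antidiagonal] at hz hz'
    have := hF _ _ _ hw.1 hw'.1
    apply hne
    ext <;> simp only at * <;> omega

/-- The solutions of `x y + z w = N` in natural numbers with
`(x, y, z, w) ≡ (α, β, γ, δ)` modulo `8`. -/
def quadSols (α β γ δ N : ℕ) : Finset ((ℕ × ℕ) × (ℕ × ℕ)) :=
  additivePairs (factorPairs α β) (factorPairs γ δ) N

theorem card_quadSols (α β γ δ N : ℕ) : (quadSols α β γ δ N).card =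
    ∑ z ∈ Finset.HasAntidiagonal.antidiagonal N,
      (factorPairs α β z.1).card * (factorPairs γ δ z.2).card := by
  refine card_additivePairs ?_ N
  intro k k' z h h'
  simp only [factorPairs, Finset.mem_filter, Nat.mem_divisorsAntidiagonal] at h h'
  rw [← h.1.1, ← h'.1.1]

theorem mem_quadSols {α β γ δ N : ℕ} (hα : 0 < α) (hβ : 0 < β) (hγ : 0 < γ) (hδ : 0 < δ)
    {d d' e e' : ℕ} : ((d, d'), (e, e')) ∈ quadSols α β γ δ N ↔
      (d % 8 = α ∧ d' % 8 = β ∧ e % 8 = γ ∧ e' % 8 = δ) ∧ d * d' + e * e' = N := by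
  simp only [quadSols, mem_additivePairs, factorPairs, Finset.mem_filter,
    Nat.mem_divisorsAntidiagonal]
  constructor
  · rintro ⟨k, l, h, ⟨⟨rfl, -⟩, h1, h2⟩, ⟨⟨rfl, -⟩, h3, h4⟩⟩
    exact ⟨⟨h1, h2, h3, h4⟩, h⟩
  · rintro ⟨⟨h1, h2, h3, h4⟩, h⟩
    refine ⟨_, _, h, ⟨⟨rfl, ?_⟩, h1, h2⟩, ⟨⟨rfl, ?_⟩, h3, h4⟩⟩ <;>
    refine mul_ne_zero ?_ ?_ <;> rintro rfl <;> omega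

theorem card_quadSols_swap {α β γ δ : ℕ} (hα : 0 < α) (hβ : 0 < β) (hγ : 0 < γ) (hδ : 0 < δ)
    (N : ℕ) (P : (ℕ × ℕ) × (ℕ × ℕ) → Prop) [DecidablePred P] :
    ((quadSols α β γ δ N).filter P).card =
      ((quadSols γ δ α β N).filter fun z => P z.swap).card := by
  refine Finset.card_bij' (fun z _ => z.swap) (fun z _ => z.swap) ?_ ?_ ?_ ?_
  · rintro ⟨⟨d, d'⟩, ⟨e, e'⟩⟩ h
    rw [Finset.mem_filter, mem_quadSols hα hβ hγ hδ] at h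
    simp only [Prod.swap, Finset.mem_filter, mem_quadSols hγ hδ hα hβ]
    exact ⟨⟨by tauto, by rw [← h.1.2]; ring⟩, h.2⟩
  · rintro ⟨⟨d, d'⟩, ⟨e, e'⟩⟩ h
    rw [Finset.mem_filter, mem_quadSols hγ hδ hα hβ] at h
    simp only [Prod.swap, Finset.mem_filter, mem_quadSols hα hβ hγ hδ]
    exact ⟨⟨by tauto, by rw [← h.1.2]; ring⟩, h.2⟩
  · simp
  · simp

theorem card_quadSols_transpose {α β γ δ : ℕ} (hα : 0 < α) (hβ : 0 < β) (hγ : 0 < γ)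
    (hδ : 0 < δ) (N : ℕ) (P : (ℕ × ℕ) × (ℕ × ℕ) → Prop) [DecidablePred P] :
    ((quadSols α β γ δ N).filter P).card =
      ((quadSols β α δ γ N).filter fun z => P (z.1.swap, z.2.swap)).card := by
  refine Finset.card_bij' (fun z _ => (z.1.swap, z.2.swap)) (fun z _ => (z.1.swap, z.2.swap))
    ?_ ?_ ?_ ?_
  · rintro ⟨⟨d, d'⟩, ⟨e, e'⟩⟩ h
    rw [Finset.mem_filter, mem_quadSols hα hβ hγ hδ] at h
    simp only [Prod.swap, Finset.mem_filter, mem_quadSols hβ hα hδ hγ]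
    exact ⟨⟨by tauto, by rw [← h.1.2]; ring⟩, h.2⟩
  · rintro ⟨⟨d, d'⟩, ⟨e, e'⟩⟩ h
    rw [Finset.mem_filter, mem_quadSols hβ hα hδ hγ] at h
    simp only [Prod.swap, Finset.mem_filter, mem_quadSols hα hβ hγ hδ]
    exact ⟨⟨by tauto, by rw [← h.1.2]; ring⟩, h.2⟩
  · simp
  · simp

/-- The Liouville-type bijection between solutions `((x, y), (z, w))`. On the left put `u = x + z`
and `v = y - w`; on the right the
same quantities are `u = x - z` and `v = y + w`. One direction reduces the fourth entry modulo `v`,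
the inverse reduces the third entry modulo `u`. -/
theorem card_quadSols_exchange {α α' β β' : ℕ} (hα : 0 < α) (hα' : 0 < α') (hβ : 0 < β)
    (hβ' : 0 < β') (hαα' : α + α' = 8) (hββ' : β + β' = 8) (N : ℕ) :
    ((quadSols α β α' β N).filter fun z => z.2.2 < z.1.2).card =
      ((quadSols α β α β' N).filter fun z => z.2.1 < z.1.1).card := by
  refine Finset.card_bij'
    (fun z _ =>
      ((z.1.1 + (z.2.2 / (z.1.2 - z.2.2) + 1) * (z.1.1 + z.2.1), z.2.2 % (z.1.2 - z.2.2)),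
        (z.1.1 + z.2.2 / (z.1.2 - z.2.2) * (z.1.1 + z.2.1),
          (z.1.2 - z.2.2) - z.2.2 % (z.1.2 - z.2.2))))
    (fun z _ =>
      ((z.2.1 % (z.1.1 - z.2.1), z.1.2 + (z.2.1 / (z.1.1 - z.2.1) + 1) * (z.1.2 + z.2.2)),
        ((z.1.1 - z.2.1) - z.2.1 % (z.1.1 - z.2.1),
          z.1.2 + z.2.1 / (z.1.1 - z.2.1) * (z.1.2 + z.2.2)))) ?_ ?_ ?_ ?_
  · rintro ⟨⟨d, d'⟩, ⟨e, e'⟩⟩ h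
    rw [Finset.mem_filter, mem_quadSols hα hβ hα' hβ] at h
    obtain ⟨⟨⟨h1, h2, h3, h4⟩, hN⟩, hlt⟩ := h
    simp only at hlt
    obtain ⟨v, rfl⟩ := Nat.exists_eq_add_of_lt hlt
    rw [Finset.mem_filter, mem_quadSols hα hβ hα hβ']
    simp only [show e' + v + 1 - e' = v + 1 by omega]
    obtain ⟨V, hV⟩ : 8 ∣ v + 1 := by omega
    obtain ⟨U, hU⟩ : 8 ∣ d + e := by omega
    have hr := Nat.mod_lt e' (Nat.succ_pos v)
    have hq := Nat.div_add_mod e' (v + 1)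
    generalize e' % (v + 1) = r at *
    generalize e' / (v + 1) = q at *
    obtain ⟨s, hs⟩ := Nat.exists_eq_add_of_lt hr
    have hs' : v + 1 - r = s + 1 := by omega
    have hrm : r % 8 = β := by
      rw [hV, mul_assoc] at hq
      omega
    have hqu : q * (d + e) = 8 * (q * U) := by rw [hU]; ring
    have hqu' : (q + 1) * (d + e) = 8 * (q * U) + 8 * U := by rw [hU]; ring
    refine ⟨⟨⟨by omega, hrm, by omega, by omega⟩, ?_⟩, by omega⟩
    rw [hs', ← hN, ← hq, add_assoc _ v 1]
    rw [show v + 1 = r + (s + 1) by omega]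
    ring
  · rintro ⟨⟨d, d'⟩, ⟨e, e'⟩⟩ h
    rw [Finset.mem_filter, mem_quadSols hα hβ hα hβ'] at h
    obtain ⟨⟨⟨h1, h2, h3, h4⟩, hN⟩, hlt⟩ := h
    simp only at hlt
    obtain ⟨u, rfl⟩ := Nat.exists_eq_add_of_lt hlt
    rw [Finset.mem_filter, mem_quadSols hα hβ hα' hβ]
    simp only [show e + u + 1 - e = u + 1 by omega]
    obtain ⟨U, hU⟩ : 8 ∣ u + 1 := by omega
    obtain ⟨V, hV⟩ : 8 ∣ d' + e' := by omega
    have hr := Nat.mod_lt e (Nat.succ_pos u)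
    have hq := Nat.div_add_mod e (u + 1)
    generalize e % (u + 1) = r at *
    generalize e / (u + 1) = q at *
    obtain ⟨s, hs⟩ := Nat.exists_eq_add_of_lt hr
    have hs' : u + 1 - r = s + 1 := by omega
    have hrm : r % 8 = α := by
      rw [hU, mul_assoc] at hq
      omega
    have hqv : q * (d' + e') = 8 * (q * V) := by rw [hV]; ring
    have hqv' : (q + 1) * (d' + e') = 8 * (q * V) + 8 * V := by rw [hV]; ring
    refine ⟨⟨⟨hrm, by omega, by omega, by omega⟩, ?_⟩, by omega⟩
    rw [hs', ← hN, ← hq, add_assoc _ u 1]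
    rw [show u + 1 = r + (s + 1) by omega]
    ring
  · rintro ⟨⟨d, d'⟩, ⟨e, e'⟩⟩ h
    rw [Finset.mem_filter, mem_quadSols hα hβ hα' hβ] at h
    obtain ⟨⟨⟨h1, h2, h3, h4⟩, hN⟩, hlt⟩ := h
    simp only at hlt ⊢
    have hr := Nat.mod_lt e' (show 0 < d' - e' by omega)
    have hq := Nat.mod_add_div' e' (d' - e')
    generalize e' % (d' - e') = r at *
    generalize e' / (d' - e') = q at *
    rw [show d + (q + 1) * (d + e) - (d + q * (d + e)) = d + e by
      rw [add_mul, one_mul]; omega, Nat.add_mul_mod_self_right,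
      Nat.mod_eq_of_lt (show d < d + e by omega), Nat.add_mul_div_right _ _ (by omega),
      Nat.div_eq_of_lt (show d < d + e by omega), zero_add,
      show r + (d' - e' - r) = d' - e' by omega, hq, add_mul, one_mul, ← add_assoc, hq]
    ext <;> simp only <;> omega
  · rintro ⟨⟨d, d'⟩, ⟨e, e'⟩⟩ h
    rw [Finset.mem_filter, mem_quadSols hα hβ hα hβ'] at h
    obtain ⟨⟨⟨h1, h2, h3, h4⟩, hN⟩, hlt⟩ := h
    simp only at hlt ⊢
    have hr := Nat.mod_lt e (show 0 < d - e by omega)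
    have hq := Nat.mod_add_div' e (d - e)
    generalize e % (d - e) = r at *
    generalize e / (d - e) = q at *
    rw [show d' + (q + 1) * (d' + e') - (d' + q * (d' + e')) = d' + e' by
      rw [add_mul, one_mul]; omega, Nat.add_mul_mod_self_right,
      Nat.mod_eq_of_lt (show d' < d' + e' by omega), Nat.add_mul_div_right _ _ (by omega),
      Nat.div_eq_of_lt (show d' < d' + e' by omega), zero_add,
      show r + (d - e - r) = d - e by omega, hq, add_mul, one_mul, ← add_assoc, hq]
    ext <;> simp only <;> omega

theorem card_quadSols_diagonal {α α' β n : ℕ} (hα : 0 < α) (hα' : 0 < α') (hαα' : α + α' = 8)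
    (hβ : β % 2 = 1) (hn : 0 < n) :
    ((quadSols α β α' β (8 * n)).filter fun z => z.1.2 = z.2.2).card =
      ∑ b ∈ n.divisors with b % 8 = β, n / b := by
  have hβ0 : 0 < β := by omega
  rw [Finset.card_eq_sum_card_fiberwise (f := fun z => z.1.2)
    (t := n.divisors.filter fun b => b % 8 = β)]
  · refine Finset.sum_congr rfl fun b hb => ?_
    rw [Finset.mem_filter, Nat.mem_divisors] at hb
    obtain ⟨⟨⟨m, rfl⟩, -⟩, hb⟩ := hb
    rw [Nat.mul_div_cancel_left _ (by omega)]
    refine Eq.trans ?_ (Finset.card_range m)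
    symm
    refine Finset.card_bij
      (fun t _ => (((8 * t + α, b), (8 * (m - 1 - t) + α', b)) : (ℕ × ℕ) × (ℕ × ℕ))) ?_ ?_ ?_
    · intro t ht
      rw [Finset.mem_range] at ht
      rw [Finset.mem_filter, Finset.mem_filter, mem_quadSols hα hβ0 hα' hβ0]
      refine ⟨⟨⟨⟨by omega, hb, by omega, hb⟩, ?_⟩, rfl⟩, rfl⟩
      rw [← add_mul, show 8 * t + α + (8 * (m - 1 - t) + α') = 8 * m by omega]
      ring
    · intro t _ t' _ h
      simp only [Prod.mk.injEq] at h
      omega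
    · rintro ⟨⟨d, d'⟩, ⟨e, e'⟩⟩ h
      rw [Finset.mem_filter, Finset.mem_filter, mem_quadSols hα hβ0 hα' hβ0] at h
      obtain ⟨⟨⟨⟨h1, h2, h3, h4⟩, hN⟩, heq⟩, rfl⟩ := h
      simp only at heq hN ⊢
      subst heq
      have hde : d + e = 8 * m := by
        refine Nat.eq_of_mul_eq_mul_right (show 0 < d' by omega) ?_
        rw [add_mul, hN]; ring
      refine ⟨d / 8, Finset.mem_range.mpr (by omega), ?_⟩
      ext <;> simp only <;> omega
  · rintro ⟨⟨d, d'⟩, ⟨e, e'⟩⟩ h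
    rw [Finset.mem_coe, Finset.mem_filter, mem_quadSols hα hβ0 hα' hβ0] at h
    obtain ⟨⟨⟨h1, h2, h3, h4⟩, hN⟩, heq⟩ := h
    simp only at heq
    subst heq
    rw [Finset.mem_coe, Finset.mem_filter, Nat.mem_divisors]
    refine ⟨⟨?_, hn.ne'⟩, h2⟩
    have hodd : Nat.Coprime d' 8 :=
      Nat.Coprime.pow_right 3 (Nat.coprime_two_right.mpr (Nat.odd_iff.mpr (by omega)))
    exact hodd.dvd_of_dvd_mul_left ⟨d + e, by rw [← hN]; ring⟩

theorem Finset.card_eq_card_filter_lt_add {ι : Type*} (s : Finset ι) (f g : ι → ℕ) :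
    s.card = (s.filter fun z => f z < g z).card + (s.filter fun z => g z < f z).card +
      (s.filter fun z => g z = f z).card := by
  simp only [Finset.card_filter, Finset.card_eq_sum_ones s]
  rw [← Finset.sum_add_distrib, ← Finset.sum_add_distrib]
  refine Finset.sum_congr rfl fun z _ => ?_
  rcases lt_trichotomy (f z) (g z) with h | h | h <;> split_ifs <;> omega

theorem card_quadSols_opposite_left {α α' β n : ℕ} (hα : 0 < α) (hα' : 0 < α')
    (hαα' : α + α' = 8) (hβ : β % 2 = 1) (hn : 0 < n) :
    (quadSols α β α' β (8 * n)).card =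
      ((quadSols α β α' β (8 * n)).filter fun z => z.2.2 < z.1.2).card +
      ((quadSols α' β α β (8 * n)).filter fun z => z.2.2 < z.1.2).card +
      ∑ b ∈ n.divisors with b % 8 = β, n / b := by
  have hβ0 : 0 < β := by omega
  rw [Finset.card_eq_card_filter_lt_add _ (fun z => z.2.2) fun z => z.1.2,
    card_quadSols_diagonal hα hα' hαα' hβ hn,
    card_quadSols_swap hα hβ0 hα' hβ0 _ fun z => z.1.2 < z.2.2]
  rfl

theorem card_quadSols_opposite_right {α β β' n : ℕ} (hβ : 0 < β) (hβ' : 0 < β')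
    (hββ' : β + β' = 8) (hα : α % 2 = 1) (hn : 0 < n) :
    (quadSols α β α β' (8 * n)).card =
      ((quadSols α β α β' (8 * n)).filter fun z => z.2.1 < z.1.1).card +
      ((quadSols α β' α β (8 * n)).filter fun z => z.2.1 < z.1.1).card +
      ∑ b ∈ n.divisors with b % 8 = α, n / b := by
  have hα0 : 0 < α := by omega
  rw [Finset.card_eq_card_filter_lt_add _ (fun z => z.2.1) fun z => z.1.1,
    card_quadSols_swap hα0 hβ hα0 hβ' _ fun z => z.1.1 < z.2.1,
    card_quadSols_transpose hα0 hβ hα0 hβ' _ fun z => z.1.1 = z.2.1]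
  rw [← card_quadSols_diagonal hβ hβ' hββ' hα hn]
  rfl

theorem sum_chi8_mul_divisors {n : ℕ} (hn : 0 < n) :
    ∑ d ∈ n.divisors, chi8 ((n / d : ℕ) : ℤ) * (d : ℤ) =
      (∑ b ∈ n.divisors with b % 8 = 1, n / b : ℕ) + (∑ b ∈ n.divisors with b % 8 = 7, n / b : ℕ) -
      (∑ b ∈ n.divisors with b % 8 = 3, n / b : ℕ) -
      (∑ b ∈ n.divisors with b % 8 = 5, n / b : ℕ) := by
  have e := Nat.sum_div_divisors n fun b => chi8 (b : ℤ) * ((n / b : ℕ) : ℤ)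
  rw [Finset.sum_congr rfl fun d hd => by
    rw [Nat.div_div_self (Nat.dvd_of_mem_divisors hd) hn.ne']] at e
  rw [e]
  simp only [Nat.cast_sum, Finset.sum_filter, Nat.cast_ite, Nat.cast_zero]
  rw [← Finset.sum_add_distrib, ← Finset.sum_sub_distrib, ← Finset.sum_sub_distrib]
  refine Finset.sum_congr rfl fun b _ => ?_
  simp only [chi8]
  generalize ((n / b : ℕ) : ℤ) = m
  split_ifs <;> omega

theorem sum_card_oddPairs_mul {n : ℕ} (hn : 0 < n) :
    ((∑ z ∈ Finset.HasAntidiagonal.antidiagonal (8 * n),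
        (oddPairs 2 z.1).card * (oddPairs 4 z.2).card : ℕ) : ℤ) =
      ∑ d ∈ n.divisors, chi8 ((n / d : ℕ) : ℤ) * (d : ℤ) := by
  have h1 := card_quadSols_opposite_left (α := 3) (α' := 5) (β := 1) (n := n)
    (by norm_num) (by norm_num) rfl rfl hn
  have h2 := card_quadSols_opposite_left (α := 5) (α' := 3) (β := 7) (n := n)
    (by norm_num) (by norm_num) rfl rfl hn
  have h3 := card_quadSols_opposite_right (α := 3) (β := 1) (β' := 7) (n := n)
    (by norm_num) (by norm_num) rfl rfl hn
  have h4 := card_quadSols_opposite_right (α := 5) (β := 7) (β' := 1) (n := n)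
    (by norm_num) (by norm_num) rfl rfl hn
  rw [card_quadSols_exchange (α := 3) (α' := 5) (β := 1) (β' := 7) (by norm_num) (by norm_num)
      (by norm_num) (by norm_num) rfl rfl,
    card_quadSols_exchange (α := 5) (α' := 3) (β := 1) (β' := 7) (by norm_num) (by norm_num)
      (by norm_num) (by norm_num) rfl rfl] at h1
  rw [card_quadSols_exchange (α := 5) (α' := 3) (β := 7) (β' := 1) (by norm_num) (by norm_num)
      (by norm_num) (by norm_num) rfl rfl,
    card_quadSols_exchange (α := 3) (α' := 5) (β := 7) (β' := 1) (by norm_num) (by norm_num)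
      (by norm_num) (by norm_num) rfl rfl] at h2
  rw [sum_chi8_mul_divisors hn]
  push_cast [card_oddPairs_two, card_oddPairs_four]
  have e : ∀ α β γ δ : ℕ, ((quadSols α β γ δ (8 * n)).card : ℤ) =
      ∑ z ∈ Finset.HasAntidiagonal.antidiagonal (8 * n),
        ((factorPairs α β z.1).card : ℤ) * (factorPairs γ δ z.2).card := by
    intro α β γ δ
    rw [card_quadSols]
    push_cast
    rfl
  simp only [sub_mul, mul_sub, Finset.sum_sub_distrib]
  rw [← e, ← e, ← e, ← e, h1, h2, h3, h4]
  push_cast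
  ring

theorem deltaRep_eq_sum_card_oddPairs {n : ℕ} (hn : 1 ≤ n) :
    deltaRep 4 ![1, 1, 2, 4] (n - 1) =
      ∑ z ∈ Finset.HasAntidiagonal.antidiagonal (8 * n),
        (oddPairs 2 z.1).card * (oddPairs 4 z.2).card := by
  rw [← card_additivePairs (by
    intro k k' z h h'
    rw [mem_oddPairs two_pos] at h h'
    rw [← h.2, ← h'.2]), ← Set.ncard_coe_finset]
  have tri (x : ℕ) : (2 * x + 1) ^ 2 = 8 * (x * (x + 1) / 2) + 1 := by
    have := Nat.div_mul_cancel (Nat.even_mul_succ_self x).two_dvd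
    nlinarith
  refine Set.ncard_congr
    (fun x _ => ((2 * x 0 + 1, 2 * x 2 + 1), (2 * x 1 + 1, 2 * x 3 + 1))) ?_ ?_ ?_
  · intro x hx
    simp only [Set.mem_ofPred_eq, Fin.sum_univ_four] at hx
    simp at hx
    rw [Finset.mem_coe, mem_additivePairs]
    refine ⟨_, _, ?_, (mem_oddPairs two_pos).mpr ⟨⟨by simp, by simp⟩, rfl⟩,
      (mem_oddPairs four_pos).mpr ⟨⟨by simp, by simp⟩, rfl⟩⟩
    simp only [tri]
    omega
  · intro x y _ _ h
    simp only [Prod.mk.injEq] at h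
    funext i
    fin_cases i <;> simp <;> omega
  · rintro ⟨⟨a, b⟩, ⟨c, d⟩⟩ h
    rw [Finset.mem_coe, mem_additivePairs] at h
    obtain ⟨k, l, hkl, h1, h2⟩ := h
    rw [mem_oddPairs two_pos] at h1
    rw [mem_oddPairs four_pos] at h2
    obtain ⟨⟨ha, hb⟩, rfl⟩ := h1
    obtain ⟨⟨hc, hd⟩, rfl⟩ := h2
    simp only at ha hb hc hd hkl
    obtain ⟨a, rfl⟩ := Nat.odd_iff.mpr ha
    obtain ⟨b, rfl⟩ := Nat.odd_iff.mpr hb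
    obtain ⟨c, rfl⟩ := Nat.odd_iff.mpr hc
    obtain ⟨d, rfl⟩ := Nat.odd_iff.mpr hd
    refine ⟨![a, c, b, d], ?_, by simp⟩
    simp only [tri] at hkl
    simp only [Set.mem_ofPred_eq, Fin.sum_univ_four]
    simp
    omega

theorem delta_1124_formula (n : ℕ) (hn : 1 ≤ n) :
    (deltaRep 4 ![1, 1, 2, 4] (n - 1) : ℤ) =
      ∑ d ∈ n.divisors, chi8 ((n / d : ℕ) : ℤ) * (d : ℤ) := by
  rw [deltaRep_eq_sum_card_oddPairs hn, sum_card_oddPairs_mul hn]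
end

section
/- For every integer n ≥ 1, δ₆(1,1,1,1,2,2; n−1) = Σ_{d∣n} χ₋₄(n/d)·d²; that is, the number of 6-tuples (x₁,…,x₆) of nonnegative integers with n − 1 = x₁(x₁+1)/2 + x₂(x₂+1)/2 + x₃(x₃+1)/2 + x₄(x₄+1)/2 + 2·x₅(x₅+1)/2 + 2·x₆(x₆+1)/2 equals Σ_{d∣n} χ₋₄(n/d)·d². -/
/-- The quadratic character mod 4: `χ₋₄(m) = 1` if `m ≡ 1 (mod 4)`, `-1` if
`m ≡ 3 (mod 4)`, `0` if `m` is even. -/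
def chiNeg4 (m : ℤ) : ℤ :=
  if m % 4 = 1 then 1 else if m % 4 = 3 then -1 else 0

/-- The quadruples `(a, x, b, y)` of odd natural numbers with `a * x + b * y = 2 * n`. -/
def oddQuads (n : ℕ) : Finset (ℕ × ℕ × ℕ × ℕ) :=
  (Finset.range (2 * n + 1) ×ˢ Finset.range (2 * n + 1) ×ˢ Finset.range (2 * n + 1) ×ˢ
    Finset.range (2 * n + 1)).filter fun q =>
      (Odd q.1 ∧ Odd q.2.1 ∧ Odd q.2.2.1 ∧ Odd q.2.2.2) ∧ q.1 * q.2.1 + q.2.2.1 * q.2.2.2 = 2 * n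

lemma mem_oddQuads {n a x b y : ℕ} : (a, x, b, y) ∈ oddQuads n ↔
    (Odd a ∧ Odd x ∧ Odd b ∧ Odd y) ∧ a * x + b * y = 2 * n := by
  simp only [oddQuads, Finset.mem_filter, Finset.mem_product, Finset.mem_range,
    and_iff_right_iff_imp]
  rintro ⟨⟨ha, hx, hb, hy⟩, h⟩
  have h1 := Nat.le_mul_of_pos_right a hx.pos
  have h2 := Nat.le_mul_of_pos_left x ha.pos
  have h3 := Nat.le_mul_of_pos_right b hy.pos
  have h4 := Nat.le_mul_of_pos_left y hb.pos
  omega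

/-- The involution `(a, x, b, y) ↦ (b, y, a, x)`. -/
def swapQuad (q : ℕ × ℕ × ℕ × ℕ) : ℕ × ℕ × ℕ × ℕ := (q.2.2.1, q.2.2.2, q.1, q.2.1)

lemma swapQuad_mem_oddQuads {n : ℕ} {q : ℕ × ℕ × ℕ × ℕ} (hq : q ∈ oddQuads n) :
    swapQuad q ∈ oddQuads n := by
  obtain ⟨a, x, b, y⟩ := q
  rw [mem_oddQuads] at hq
  rw [swapQuad, mem_oddQuads]
  exact ⟨by tauto, by linarith [hq.2]⟩

lemma sum_oddQuads_split (n : ℕ) (k : ℕ × ℕ × ℕ × ℕ → ℕ) (F : ℕ × ℕ × ℕ × ℕ → ℤ) :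
    ∑ q ∈ oddQuads n, F q =
      ∑ q ∈ oddQuads n with k q < k (swapQuad q), (F q + F (swapQuad q)) +
        ∑ q ∈ oddQuads n with k q = k (swapQuad q), F q := by
  have hswap : ∑ q ∈ oddQuads n with k q < k (swapQuad q), F (swapQuad q) =
      ∑ q ∈ oddQuads n with k (swapQuad q) < k q, F q := by
    refine Finset.sum_nbij' swapQuad swapQuad ?_ ?_ (fun _ _ => rfl) (fun _ _ => rfl)
      (fun _ _ => rfl) <;>
    · intro q hq
      rw [Finset.mem_filter] at hq ⊢
      exact ⟨swapQuad_mem_oddQuads hq.1, hq.2⟩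
  rw [Finset.sum_add_distrib, hswap, Finset.sum_filter, Finset.sum_filter, Finset.sum_filter,
    ← Finset.sum_add_distrib, ← Finset.sum_add_distrib]
  refine Finset.sum_congr rfl fun q _ => ?_
  rcases lt_trichotomy (k q) (k (swapQuad q)) with h | h | h
  · simp [h, h.ne, h.not_gt]
  · simp [h]
  · simp [h, h.ne', h.not_gt]

/-- The Euclidean bijection: replacing `a` by its residue modulo `b - a` trades quadruples with
`a < b` for quadruples with `y < x`, turning `(b - a, x + y)` into `(a + b, x - y)`. -/
lemma sum_oddQuads_euclid (n : ℕ) (G : ℕ → ℕ → ℕ → ℤ)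
    (hG : ∀ M e β t, Even e → G M e (β + e * t) = G M e β) :
    ∑ q ∈ oddQuads n with q.1 < q.2.2.1, G (q.2.2.1 - q.1) (q.2.1 + q.2.2.2) q.2.2.2 =
      ∑ q ∈ oddQuads n with q.2.2.2 < q.2.1,
        G (q.1 + q.2.2.1) (q.2.1 - q.2.2.2) q.2.2.2 := by
  refine Finset.sum_nbij'
    (fun q => (q.1 % (q.2.2.1 - q.1),
      q.2.2.2 + (q.2.1 + q.2.2.2) * (q.1 / (q.2.2.1 - q.1)) + (q.2.1 + q.2.2.2),
      (q.2.2.1 - q.1) - q.1 % (q.2.2.1 - q.1),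
      q.2.2.2 + (q.2.1 + q.2.2.2) * (q.1 / (q.2.2.1 - q.1))))
    (fun q => (q.1 + (q.1 + q.2.2.1) * (q.2.2.2 / (q.2.1 - q.2.2.2)),
      (q.2.1 - q.2.2.2) - q.2.2.2 % (q.2.1 - q.2.2.2),
      q.1 + (q.1 + q.2.2.1) * (q.2.2.2 / (q.2.1 - q.2.2.2)) + (q.1 + q.2.2.1),
      q.2.2.2 % (q.2.1 - q.2.2.2))) ?_ ?_ ?_ ?_ ?_
  · rintro ⟨a, x, b, y⟩ hq
    simp only [Finset.mem_filter, mem_oddQuads] at hq ⊢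
    obtain ⟨⟨⟨ha, hx, hb, hy⟩, h⟩, hab⟩ := hq
    obtain ⟨M, hM0, rfl⟩ : ∃ M, 0 < M ∧ b = a + M := ⟨b - a, by omega, by omega⟩
    rw [Nat.add_sub_cancel_left]
    have hMe : Even M := by
      rw [Nat.even_iff]; rw [Nat.odd_iff] at ha hb; omega
    have hr := Nat.mod_lt a hM0
    have hra : Odd (a % M) := by
      rw [Nat.odd_iff, Nat.mod_mod_of_dvd _ hMe.two_dvd]; exact Nat.odd_iff.1 ha
    have hdiv := Nat.mod_add_div a M
    have hxy : Even (x + y) := hx.add_odd hy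
    have hy' : Odd (y + (x + y) * (a / M)) := hy.add_even (hxy.mul_right _)
    refine ⟨⟨⟨hra, hy'.add_even hxy, ?_, hy'⟩, ?_⟩, ?_⟩
    · exact Nat.Even.sub_odd hr.le hMe hra
    · obtain ⟨s, hs⟩ := Nat.exists_eq_add_of_le hr.le
      generalize a % M = r at *
      generalize a / M = t at *
      subst hs
      rw [Nat.add_sub_cancel_left, ← h, ← hdiv]
      ring
    · have := hx.pos; omega
  · rintro ⟨a, x, b, y⟩ hq
    simp only [Finset.mem_filter, mem_oddQuads] at hq ⊢
    obtain ⟨⟨⟨ha, hx, hb, hy⟩, h⟩, hab⟩ := hq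
    obtain ⟨M, hM0, rfl⟩ : ∃ M, 0 < M ∧ x = y + M := ⟨x - y, by omega, by omega⟩
    rw [Nat.add_sub_cancel_left]
    have hMe : Even M := by
      rw [Nat.even_iff]; rw [Nat.odd_iff] at hx hy; omega
    have hr := Nat.mod_lt y hM0
    have hra : Odd (y % M) := by
      rw [Nat.odd_iff, Nat.mod_mod_of_dvd _ hMe.two_dvd]; exact Nat.odd_iff.1 hy
    have hdiv := Nat.mod_add_div y M
    have hxy : Even (a + b) := ha.add_odd hb
    have ha' : Odd (a + (a + b) * (y / M)) := ha.add_even (hxy.mul_right _)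
    refine ⟨⟨⟨ha', ?_, ha'.add_even hxy, hra⟩, ?_⟩, ?_⟩
    · exact Nat.Even.sub_odd hr.le hMe hra
    · obtain ⟨s, hs⟩ := Nat.exists_eq_add_of_le hr.le
      generalize y % M = r at *
      generalize y / M = t at *
      subst hs
      rw [Nat.add_sub_cancel_left, ← h, ← hdiv]
      ring
    · have := ha.pos; omega
  · rintro ⟨a, x, b, y⟩ hq
    simp only [Finset.mem_filter, mem_oddQuads] at hq ⊢
    obtain ⟨⟨⟨ha, hx, hb, hy⟩, h⟩, hab⟩ := hq
    have hr := Nat.mod_lt a (Nat.sub_pos_of_lt hab)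
    have hdiv := Nat.mod_add_div a (b - a)
    have hylt : y < x + y := by have := hx.pos; omega
    simp only [Nat.add_sub_cancel_left, Nat.add_sub_cancel' hr.le, Nat.add_mul_mod_self_left,
      Nat.mod_eq_of_lt hylt, Nat.add_mul_div_left _ _ (hx.pos.trans_le (Nat.le_add_right x y)),
      Nat.div_eq_of_lt hylt, zero_add, hdiv, Nat.add_sub_cancel, Nat.add_sub_cancel' hab.le]
  · rintro ⟨a, x, b, y⟩ hq
    simp only [Finset.mem_filter, mem_oddQuads] at hq ⊢
    obtain ⟨⟨⟨ha, hx, hb, hy⟩, h⟩, hab⟩ := hq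
    have hr := Nat.mod_lt y (Nat.sub_pos_of_lt hab)
    have hdiv := Nat.mod_add_div y (x - y)
    have hylt : a < a + b := by have := hb.pos; omega
    simp only [Nat.add_sub_cancel_left, Nat.sub_add_cancel hr.le, Nat.add_mul_mod_self_left,
      Nat.mod_eq_of_lt hylt, Nat.add_mul_div_left _ _ (ha.pos.trans_le (Nat.le_add_right a b)),
      Nat.div_eq_of_lt hylt, zero_add, hdiv, Nat.add_sub_cancel_left, Nat.add_sub_cancel' hab.le]
  · rintro ⟨a, x, b, y⟩ hq
    simp only [Finset.mem_filter, mem_oddQuads] at hq ⊢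
    obtain ⟨⟨⟨ha, hx, hb, hy⟩, h⟩, hab⟩ := hq
    have hr := Nat.mod_lt a (Nat.sub_pos_of_lt hab)
    rw [Nat.add_sub_cancel' hr.le, Nat.add_sub_cancel_left, hG _ _ _ _ (hx.add_odd hy)]

lemma sum_oddQuads_diag (n : ℕ) (hn : 1 ≤ n) (H : ℕ → ℕ → ℤ) :
    ∑ q ∈ oddQuads n with q.2.1 = q.2.2.2, H q.2.1 (q.1 + q.2.2.1) =
      ∑ d ∈ n.divisors with Odd (n / d), (d : ℤ) * H (n / d) (2 * d) := by
  have : ∀ d : ℕ, (d : ℤ) * H (n / d) (2 * d) = ∑ _j ∈ Finset.range d, H (n / d) (2 * d) := by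
    simp
  simp_rw [this]
  rw [Finset.sum_sigma']
  refine Finset.sum_nbij' (fun q => ⟨(q.1 + q.2.2.1) / 2, q.1 / 2⟩)
    (fun p => (2 * p.2 + 1, n / p.1, 2 * p.1 - (2 * p.2 + 1), n / p.1)) ?_ ?_ ?_ ?_ ?_
  · rintro ⟨a, x, b, y⟩ hq
    simp only [Finset.mem_filter, mem_oddQuads, Finset.mem_sigma, Nat.mem_divisors,
      Finset.mem_range] at hq ⊢
    obtain ⟨⟨⟨⟨i, rfl⟩, hx, ⟨j, rfl⟩, hy⟩, h⟩, rfl⟩ := hq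
    have e : (2 * i + 1 + (2 * j + 1)) / 2 = i + j + 1 := by omega
    have h' : (i + j + 1) * x = n := by linarith
    rw [e]
    refine ⟨⟨⟨⟨x, h'.symm⟩, by omega⟩, ?_⟩, by omega⟩
    rwa [← h', Nat.mul_div_cancel_left _ (by omega)]
  · rintro ⟨d, j⟩ hq
    simp only [Finset.mem_filter, mem_oddQuads, Finset.mem_sigma, Nat.mem_divisors,
      Finset.mem_range] at hq ⊢
    obtain ⟨⟨⟨⟨x, rfl⟩, hd⟩, hx⟩, hj⟩ := hq
    have e : d * x / d = x := Nat.mul_div_cancel_left _ (by omega)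
    rw [e] at hx ⊢
    refine ⟨⟨⟨by simp, hx, ?_, hx⟩, ?_⟩, trivial⟩
    · rw [Nat.odd_iff]; omega
    · rw [← add_mul, Nat.add_sub_cancel' (by omega)]; ring
  · rintro ⟨a, x, b, y⟩ hq
    simp only [Finset.mem_filter, mem_oddQuads] at hq
    obtain ⟨⟨⟨⟨i, rfl⟩, hx, ⟨j, rfl⟩, hy⟩, h⟩, rfl⟩ := hq
    have e : (2 * i + 1 + (2 * j + 1)) / 2 = i + j + 1 := by omega
    have h' : (i + j + 1) * x = n := by linarith
    have e' : n / (i + j + 1) = x := by rw [← h', Nat.mul_div_cancel_left _ (by omega)]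
    simp only [e, e', Prod.mk.injEq, true_and, and_true]
    omega
  · rintro ⟨d, j⟩ hq
    simp only [Finset.mem_filter, Finset.mem_sigma, Finset.mem_range] at hq
    simp only [Sigma.mk.injEq, heq_eq_eq]
    omega
  · rintro ⟨a, x, b, y⟩ hq
    simp only [Finset.mem_filter, mem_oddQuads] at hq
    obtain ⟨⟨⟨⟨i, rfl⟩, hx, ⟨j, rfl⟩, hy⟩, h⟩, rfl⟩ := hq
    have e : (2 * i + 1 + (2 * j + 1)) / 2 = i + j + 1 := by omega
    have h' : (i + j + 1) * x = n := by linarith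
    have e' : n / (i + j + 1) = x := by rw [← h', Nat.mul_div_cancel_left _ (by omega)]
    simp only [e, e']
    congr 1
    omega

lemma card_oddQuads_diag (n : ℕ) :
    ∑ q ∈ oddQuads n with q.1 = q.2.2.1, (1 : ℤ) =
      ∑ q ∈ oddQuads n with q.2.1 = q.2.2.2, (1 : ℤ) := by
  refine Finset.sum_nbij' (fun q => (q.2.1, q.1, q.2.2.2, q.2.2.1))
    (fun q => (q.2.1, q.1, q.2.2.2, q.2.2.1)) ?_ ?_ (fun _ _ => rfl) (fun _ _ => rfl)
    (fun _ _ => rfl) <;>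
  · rintro ⟨a, x, b, y⟩ hq
    simp only [Finset.mem_filter, mem_oddQuads] at hq ⊢
    exact ⟨⟨by tauto, by linarith [hq.1.2]⟩, hq.2⟩

lemma sum_chiNeg4_mul_chiNeg4 {N : ℕ} (hN : Odd N) :
    ∑ q ∈ oddQuads N, chiNeg4 q.1 * chiNeg4 q.2.2.1 = ∑ d ∈ N.divisors, (d : ℤ) := by
  let c : ℕ → ℤ := fun M => if 4 ∣ M then 1 else -1
  have h1 : ∑ q ∈ oddQuads N, c (q.1 - q.2.2.1 + (q.2.2.1 - q.1)) =
      ∑ q ∈ oddQuads N with q.1 < q.2.2.1, 2 * c (q.2.2.1 - q.1) +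
        ∑ q ∈ oddQuads N with q.2.1 = q.2.2.2, (1 : ℤ) := by
    rw [sum_oddQuads_split N (fun q => q.1), ← card_oddQuads_diag]
    congr 1 <;> refine Finset.sum_congr rfl fun q hq => ?_
    · have := (Finset.mem_filter.1 hq).2
      simp only [swapQuad] at this ⊢
      rw [Nat.sub_eq_zero_of_le this.le, zero_add, add_zero, two_mul]
    · have : q.1 = q.2.2.1 := (Finset.mem_filter.1 hq).2
      simp [this, c]
  have h2 : ∑ q ∈ oddQuads N, c (q.1 + q.2.2.1) =
      ∑ q ∈ oddQuads N with q.2.2.2 < q.2.1, 2 * c (q.1 + q.2.2.1) +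
        ∑ q ∈ oddQuads N with q.2.1 = q.2.2.2, (-1 : ℤ) := by
    rw [sum_oddQuads_split N (fun q => q.2.2.2)]
    congr 1
    · refine Finset.sum_congr rfl fun q hq => ?_
      simp only [swapQuad]
      rw [add_comm q.2.2.1, two_mul]
    · refine Finset.sum_congr (Finset.filter_congr fun _ _ => eq_comm) ?_
      rintro ⟨a, x, b, y⟩ hq
      simp only [Finset.mem_filter, mem_oddQuads] at hq ⊢
      obtain ⟨⟨-, h⟩, rfl⟩ := hq
      refine if_neg ?_
      rintro ⟨k, hk⟩
      rw [← add_mul, hk] at h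
      obtain ⟨j, rfl⟩ := hN
      have : 2 * (k * x) = 2 * j + 1 := by linarith
      omega
  have h3 := sum_oddQuads_euclid N (fun M _ _ => 2 * c M) (fun _ _ _ _ _ => rfl)
  have h4 : ∑ q ∈ oddQuads N, 2 * (chiNeg4 q.1 * chiNeg4 q.2.2.1) =
      ∑ q ∈ oddQuads N, c (q.1 - q.2.2.1 + (q.2.2.1 - q.1)) -
        ∑ q ∈ oddQuads N, c (q.1 + q.2.2.1) := by
    rw [← Finset.sum_sub_distrib]
    refine Finset.sum_congr rfl ?_
    rintro ⟨a, x, b, y⟩ hq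
    obtain ⟨⟨ha, -, hb, -⟩, -⟩ := mem_oddQuads.1 hq
    rw [Nat.odd_iff] at ha hb
    simp only [chiNeg4, c]
    split_ifs <;> first | rfl | omega
  have h5 := sum_oddQuads_diag N hN.pos (fun _ _ => 1)
  rw [Finset.filter_true_of_mem fun d hd => hN.of_dvd_nat
    (Nat.div_dvd_of_dvd (Nat.dvd_of_mem_divisors hd))] at h5
  simp only [mul_one] at h5
  rw [← Finset.mul_sum, h1, h2, Finset.sum_neg_distrib] at h4
  linarith

lemma sum_chiNeg4_mul_right {n : ℕ} (hn : 1 ≤ n) :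
    ∑ q ∈ oddQuads n, chiNeg4 q.2.1 * (q.2.2.1 : ℤ) =
      ∑ d ∈ n.divisors, chiNeg4 ((n / d : ℕ) : ℤ) * (d : ℤ) ^ 2 := by
  let G : ℕ → ℕ → ℕ → ℤ := fun M e β => if 4 ∣ e then 2 * (chiNeg4 β * M) else 0
  have hG : ∀ M e β t, Even e → G M e (β + e * t) = G M e β := by
    intro M e β t _
    by_cases he : 4 ∣ e
    · obtain ⟨k, rfl⟩ := he
      have h : ((β + 4 * k * t : ℕ) : ℤ) % 4 = (β : ℤ) % 4 := by
        push_cast; rw [mul_assoc]; omega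
      simp only [G, chiNeg4, h]
    · simp [G, he]
  have h1 : ∑ q ∈ oddQuads n, chiNeg4 q.2.1 * ((q.2.2.1 : ℤ) - q.1) =
      -∑ q ∈ oddQuads n with q.1 < q.2.2.1,
        G (q.2.2.1 - q.1) (q.2.1 + q.2.2.2) q.2.2.2 := by
    rw [sum_oddQuads_split n (fun q => q.1), ← Finset.sum_neg_distrib, add_eq_left.2]
    · refine Finset.sum_congr rfl ?_
      rintro ⟨a, x, b, y⟩ hq
      simp only [swapQuad, Finset.mem_filter, mem_oddQuads] at hq ⊢
      obtain ⟨⟨⟨-, hx, -, hy⟩, -⟩, hab⟩ := hq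
      rw [Nat.odd_iff] at hx hy
      simp only [G, chiNeg4, Nat.cast_sub hab.le]
      split_ifs <;> omega
    · refine Finset.sum_eq_zero fun q hq => ?_
      have : q.1 = q.2.2.1 := (Finset.mem_filter.1 hq).2
      rw [this, sub_self, mul_zero]
  have h2 : ∑ q ∈ oddQuads n, chiNeg4 q.2.1 * ((q.1 + q.2.2.1 : ℕ) : ℤ) =
      ∑ q ∈ oddQuads n with q.2.2.2 < q.2.1,
        G (q.1 + q.2.2.1) (q.2.1 - q.2.2.2) q.2.2.2 +
      ∑ q ∈ oddQuads n with q.2.1 = q.2.2.2, chiNeg4 q.2.1 * ((q.1 + q.2.2.1 : ℕ) : ℤ) := by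
    rw [sum_oddQuads_split n (fun q => q.2.2.2)]
    congr 1
    · refine Finset.sum_congr rfl ?_
      rintro ⟨a, x, b, y⟩ hq
      simp only [swapQuad, Finset.mem_filter, mem_oddQuads] at hq ⊢
      obtain ⟨⟨⟨-, hx, -, hy⟩, -⟩, hab⟩ := hq
      rw [Nat.odd_iff] at hx hy
      simp only [G, chiNeg4, Nat.cast_add]
      split_ifs <;> omega
    · exact Finset.sum_congr (Finset.filter_congr fun _ _ => eq_comm) fun _ _ => rfl
  have h3 := sum_oddQuads_euclid n G hG
  have h4 := sum_oddQuads_diag n hn (fun x m => chiNeg4 x * (m : ℤ))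
  have h5 : 2 * ∑ q ∈ oddQuads n, chiNeg4 q.2.1 * (q.2.2.1 : ℤ) =
      ∑ q ∈ oddQuads n, chiNeg4 q.2.1 * ((q.2.2.1 : ℤ) - q.1) +
      ∑ q ∈ oddQuads n, chiNeg4 q.2.1 * ((q.1 + q.2.2.1 : ℕ) : ℤ) := by
    rw [Finset.mul_sum, ← Finset.sum_add_distrib]
    refine Finset.sum_congr rfl fun q _ => ?_
    push_cast; ring
  have h6 : ∑ d ∈ n.divisors with Odd (n / d), (d : ℤ) *
      (chiNeg4 ((n / d : ℕ) : ℤ) * ((2 * d : ℕ) : ℤ)) =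
      2 * ∑ d ∈ n.divisors, chiNeg4 ((n / d : ℕ) : ℤ) * (d : ℤ) ^ 2 := by
    rw [Finset.sum_filter, Finset.mul_sum]
    refine Finset.sum_congr rfl fun d _ => ?_
    generalize n / d = m
    split_ifs with hm
    · push_cast; ring
    · rw [Nat.not_odd_iff] at hm
      have : chiNeg4 m = 0 := by
        simp only [chiNeg4]
        split_ifs <;> omega
      simp [this]
  linarith

lemma chiNeg4_mul (m n : ℤ) : chiNeg4 (m * n) = chiNeg4 m * chiNeg4 n := by
  have hm : m % 4 = 0 ∨ m % 4 = 1 ∨ m % 4 = 2 ∨ m % 4 = 3 := by omega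
  have hn : n % 4 = 0 ∨ n % 4 = 1 ∨ n % 4 = 2 ∨ n % 4 = 3 := by omega
  rcases hm with hm | hm | hm | hm <;> rcases hn with hn | hn | hn | hn <;>
    simp [chiNeg4, Int.mul_emod, hm, hn]

/-- The divisor sum `∑_{d ∣ n} χ₋₄(d)`. -/
def chiDivisorSum (n : ℕ) : ℤ := ∑ d ∈ n.divisors, chiNeg4 d

lemma sum_divisors_filter_dvd {p n : ℕ} (hp : p.Prime) (hn : n ≠ 0) :
    ∑ d ∈ (p * n).divisors with p ∣ d, chiNeg4 d = chiNeg4 p * chiDivisorSum n := by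
  rw [chiDivisorSum, Finset.mul_sum]
  refine (Finset.sum_nbij' (fun d => p * d) (fun d => d / p) ?_ ?_ ?_ ?_ ?_).symm
  · intro d hd
    simp only [Finset.mem_filter, Nat.mem_divisors] at hd ⊢
    exact ⟨⟨mul_dvd_mul_left p hd.1, mul_ne_zero hp.ne_zero hn⟩, dvd_mul_right _ _⟩
  · intro d hd
    simp only [Finset.mem_filter, Nat.mem_divisors] at hd ⊢
    obtain ⟨⟨h, -⟩, k, rfl⟩ := hd
    rw [Nat.mul_div_cancel_left _ hp.pos]
    exact ⟨Nat.dvd_of_mul_dvd_mul_left hp.pos h, hn⟩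
  · intro d _
    exact Nat.mul_div_cancel_left _ hp.pos
  · intro d hd
    exact Nat.mul_div_cancel' (Finset.mem_filter.1 hd).2
  · intro d _
    rw [Nat.cast_mul, chiNeg4_mul]

lemma chiDivisorSum_prime_mul {p n : ℕ} (hp : p.Prime) (hn : n ≠ 0) :
    chiDivisorSum (p * n) = (1 + chiNeg4 p) * chiDivisorSum n -
      chiNeg4 p * (if p ∣ n then chiDivisorSum (n / p) else 0) := by
  have h1 : chiDivisorSum (p * n) = ∑ d ∈ (p * n).divisors with p ∣ d, chiNeg4 d +
      ∑ d ∈ (p * n).divisors with ¬p ∣ d, chiNeg4 d :=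
    (Finset.sum_filter_add_sum_filter_not _ _ _).symm
  have h2 : chiDivisorSum n = ∑ d ∈ n.divisors with p ∣ d, chiNeg4 d +
      ∑ d ∈ n.divisors with ¬p ∣ d, chiNeg4 d :=
    (Finset.sum_filter_add_sum_filter_not _ _ _).symm
  have h3 : {d ∈ (p * n).divisors | ¬p ∣ d} = {d ∈ n.divisors | ¬p ∣ d} := by
    ext d
    simp only [Finset.mem_filter, Nat.mem_divisors]
    refine ⟨fun ⟨⟨h, _⟩, hd⟩ => ⟨⟨?_, hn⟩, hd⟩, fun ⟨⟨h, _⟩, hd⟩ =>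
      ⟨⟨h.mul_left p, mul_ne_zero hp.ne_zero hn⟩, hd⟩⟩
    exact ((Nat.Prime.coprime_iff_not_dvd hp).2 hd).symm.dvd_of_dvd_mul_left h
  have h4 : ∑ d ∈ n.divisors with p ∣ d, chiNeg4 d =
      chiNeg4 p * (if p ∣ n then chiDivisorSum (n / p) else 0) := by
    split_ifs with h
    · obtain ⟨m, rfl⟩ := h
      rw [Nat.mul_div_cancel_left _ hp.pos,
        sum_divisors_filter_dvd hp (right_ne_zero_of_mul hn)]
    · rw [mul_zero, Finset.filter_false_of_mem, Finset.sum_empty]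
      exact fun d hd hpd => h (hpd.trans (Nat.dvd_of_mem_divisors hd))
  rw [sum_divisors_filter_dvd hp hn, h3] at h1
  rw [h4] at h2
  linear_combination h1 - h2

/-- The integer points on the circle `x ^ 2 + y ^ 2 = n`. -/
def circlePoints (n : ℕ) : Set (ℤ × ℤ) := {z | z.1 ^ 2 + z.2 ^ 2 = (n : ℤ)}

lemma abs_le_of_sq_add_sq {x y n : ℤ} (h : x ^ 2 + y ^ 2 = n) : |x| ≤ n := by
  have := Int.le_self_sq |x|
  rw [sq_abs] at this
  nlinarith [sq_nonneg y]

lemma circlePoints_finite (n : ℕ) : (circlePoints n).Finite := by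
  refine ((Set.finite_Icc (-(n : ℤ)) n).prod (Set.finite_Icc (-(n : ℤ)) n)).subset ?_
  rintro ⟨x, y⟩ h
  simp only [circlePoints, Set.mem_ofPred_eq] at h
  simp only [Set.mem_prod, Set.mem_Icc, ← abs_le]
  exact ⟨abs_le_of_sq_add_sq h, abs_le_of_sq_add_sq ((add_comm _ _).trans h)⟩

lemma ncard_circlePoints_dvd {p : ℕ} (hp : p.Prime) (n : ℕ) :
    {z ∈ circlePoints (p * n) | (p : ℤ) ∣ z.1 ∧ (p : ℤ) ∣ z.2}.ncard =
      if p ∣ n then (circlePoints (n / p)).ncard else 0 := by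
  have hp0 : (p : ℤ) ≠ 0 := by exact_mod_cast hp.ne_zero
  split_ifs with h
  · obtain ⟨m, rfl⟩ := h
    rw [Nat.mul_div_cancel_left _ hp.pos]
    symm
    refine Set.ncard_congr (fun z _ => (p * z.1, p * z.2)) ?_ ?_ ?_
    · rintro ⟨x, y⟩ hz
      simp only [circlePoints, Set.mem_ofPred_eq] at hz ⊢
      refine ⟨?_, dvd_mul_right _ _, dvd_mul_right _ _⟩
      push_cast
      linear_combination (p : ℤ) ^ 2 * hz
    · rintro ⟨x, y⟩ ⟨u, v⟩ - - h
      simpa [hp.ne_zero] using h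
    · rintro ⟨_, _⟩ ⟨hz, ⟨x, rfl⟩, ⟨y, rfl⟩⟩
      refine ⟨(x, y), ?_, rfl⟩
      simp only [circlePoints, Set.mem_ofPred_eq] at hz ⊢
      push_cast at hz
      refine mul_left_cancel₀ (pow_ne_zero 2 hp0) ?_
      linear_combination hz
  · rw [Set.ncard_eq_zero ((circlePoints_finite _).subset (Set.sep_subset _ _)),
      Set.eq_empty_iff_forall_notMem]
    rintro ⟨_, _⟩ ⟨hz, ⟨x, rfl⟩, ⟨y, rfl⟩⟩
    refine h (Int.natCast_dvd_natCast.1 ⟨x ^ 2 + y ^ 2, ?_⟩)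
    simp only [circlePoints, Set.mem_ofPred_eq] at hz
    push_cast at hz
    refine mul_left_cancel₀ hp0 ?_
    linear_combination -hz

/-- Multiplication by a Gaussian integer of norm `p` identifies the points of norm `n` with
those points of norm `p * n` that are divisible by it. -/
lemma ncard_circlePoints_gaussian {p : ℕ} (hp : p ≠ 0) (n : ℕ) {a b : ℤ}
    (hab : a ^ 2 + b ^ 2 = p) :
    {z ∈ circlePoints (p * n) | (p : ℤ) ∣ a * z.1 + b * z.2 ∧ (p : ℤ) ∣ b * z.1 - a * z.2}.ncard =
      (circlePoints n).ncard := by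
  have hp0 : (p : ℤ) ≠ 0 := by exact_mod_cast hp
  symm
  refine Set.ncard_congr (fun z _ => (a * z.1 + b * z.2, b * z.1 - a * z.2)) ?_ ?_ ?_
  · rintro ⟨x, y⟩ hz
    simp only [circlePoints, Set.mem_ofPred_eq] at hz ⊢
    refine ⟨?_, ⟨x, ?_⟩, ⟨y, ?_⟩⟩
    · push_cast
      linear_combination (a ^ 2 + b ^ 2) * hz + n * hab
    · linear_combination x * hab
    · linear_combination y * hab
  · rintro ⟨x, y⟩ ⟨u, v⟩ - - h
    simp only [Prod.mk.injEq] at h ⊢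
    constructor <;> refine mul_left_cancel₀ hp0 ?_
    · linear_combination a * h.1 + b * h.2 - (x - u) * hab
    · linear_combination b * h.1 - a * h.2 - (y - v) * hab
  · rintro ⟨x, y⟩ ⟨hz, ⟨u, hu⟩, ⟨v, hv⟩⟩
    simp only [circlePoints, Set.mem_ofPred_eq] at hz hu hv
    push_cast at hz
    refine ⟨(u, v), ?_, ?_⟩
    · simp only [circlePoints, Set.mem_ofPred_eq]
      refine mul_left_cancel₀ (pow_ne_zero 2 hp0) ?_
      linear_combination -(p * u + (a * x + b * y)) * hu - (p * v + (b * x - a * y)) * hv +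
        (a ^ 2 + b ^ 2) * hz + p * n * hab
    · simp only [Prod.mk.injEq]
      constructor <;> refine mul_left_cancel₀ hp0 ?_
      · linear_combination -a * hu - b * hv + x * hab
      · linear_combination -b * hu + a * hv + y * hab

lemma dvd_of_dvd_sq_add_sq {p : ℕ} (hp : p.Prime) (h3 : p % 4 = 3) {x y : ℤ}
    (h : (p : ℤ) ∣ x ^ 2 + y ^ 2) : (p : ℤ) ∣ y := by
  have := Fact.mk hp
  by_contra hy
  have hy' : (y : ZMod p) ≠ 0 := by rwa [Ne, ZMod.intCast_zmod_eq_zero_iff_dvd]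
  have h' : (x : ZMod p) ^ 2 + (y : ZMod p) ^ 2 = 0 := by
    have := (ZMod.intCast_zmod_eq_zero_iff_dvd (x ^ 2 + y ^ 2) p).2 h
    exact_mod_cast this
  refine ZMod.mod_four_ne_three_of_sq_eq_neg_sq' hy' (x := (x : ZMod p)) ?_ h3
  linear_combination h'

lemma ncard_circlePoints_prime_mul {p : ℕ} (hp : p.Prime) (hp2 : Odd p) (n : ℕ) :
    ((circlePoints (p * n)).ncard : ℤ) = (1 + chiNeg4 p) * (circlePoints n).ncard -
      chiNeg4 p * (if p ∣ n then ((circlePoints (n / p)).ncard : ℤ) else 0) := by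
  have hdvd := ncard_circlePoints_dvd hp n
  have hpZ : Prime (p : ℤ) := Nat.prime_iff_prime_int.1 hp
  have hcast : (if p ∣ n then ((circlePoints (n / p)).ncard : ℤ) else 0) =
      ((if p ∣ n then (circlePoints (n / p)).ncard else 0 : ℕ) : ℤ) := by split_ifs <;> rfl
  rw [hcast, ← hdvd]
  have h13 : p % 4 = 1 ∨ p % 4 = 3 := by rw [Nat.odd_iff] at hp2; omega
  rcases h13 with h1 | h3
  · have hchi : chiNeg4 p = 1 := if_pos (by omega)
    have := Fact.mk hp
    obtain ⟨a, b, hab⟩ := Nat.Prime.sq_add_sq (p := p) (by omega)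
    have hab1 : (a : ℤ) ^ 2 + (b : ℤ) ^ 2 = p := by exact_mod_cast hab
    have hab2 : (a : ℤ) ^ 2 + (-b : ℤ) ^ 2 = p := by rw [neg_sq]; exact hab1
    have hA := ncard_circlePoints_gaussian hp.ne_zero n hab1
    have hB := ncard_circlePoints_gaussian hp.ne_zero n hab2
    have hcop : ∀ c : ℤ, c ^ 2 < p → c ≠ 0 → ¬(p : ℤ) ∣ 2 * c := by
      intro c hc hc0 h
      rcases hpZ.dvd_or_dvd h with h | h
      · have := Int.le_of_dvd two_pos h
        have := hp.two_le
        rw [Nat.odd_iff] at hp2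
        omega
      · have := Int.le_of_dvd (by positivity) (h.trans (dvd_pow_self c two_ne_zero))
        omega
    have ha0 : (a : ℤ) ≠ 0 := by
      rintro h
      rw [h, zero_pow two_ne_zero, zero_add] at hab1
      exact hpZ.irreducible.not_isSquare ⟨b, by rw [← hab1, sq]⟩
    have hb0 : (b : ℤ) ≠ 0 := by
      rintro h
      rw [h, zero_pow two_ne_zero, add_zero] at hab1
      exact hpZ.irreducible.not_isSquare ⟨a, by rw [← hab1, sq]⟩
    have hap := hcop a (by have : 0 < (b : ℤ) ^ 2 := by positivity
                           omega) ha0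
    have hbp := hcop b (by have : 0 < (a : ℤ) ^ 2 := by positivity
                           omega) hb0
    have hu : {z ∈ circlePoints (p * n) | (p : ℤ) ∣ a * z.1 + b * z.2 ∧
          (p : ℤ) ∣ b * z.1 - a * z.2} ∪ {z ∈ circlePoints (p * n) |
          (p : ℤ) ∣ a * z.1 + -b * z.2 ∧ (p : ℤ) ∣ -b * z.1 - a * z.2} =
        circlePoints (p * n) := by
      rw [← Set.sep_or, Set.sep_eq_self_iff_mem_true]
      rintro ⟨x, y⟩ hz
      simp only [circlePoints, Set.mem_ofPred_eq] at hz
      push_cast at hz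
      have h1 : (p : ℤ) ∣ (a * x + b * y) * (a * x + -b * y) :=
        ⟨a ^ 2 * n - y ^ 2, by linear_combination a ^ 2 * hz - y ^ 2 * hab1⟩
      rcases hpZ.dvd_or_dvd h1 with h | h
      · refine Or.inl ⟨h, hpZ.dvd_of_dvd_pow (n := 2) ?_⟩
        obtain ⟨k, hk⟩ := h
        refine ⟨p * n - (a * x + b * y) * k, ?_⟩
        linear_combination p * hz + (x ^ 2 + y ^ 2) * hab1 - (a * x + b * y) * hk
      · refine Or.inr ⟨h, hpZ.dvd_of_dvd_pow (n := 2) ?_⟩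
        obtain ⟨k, hk⟩ := h
        refine ⟨p * n - (a * x + -b * y) * k, ?_⟩
        linear_combination p * hz + (x ^ 2 + y ^ 2) * hab1 - (a * x + -b * y) * hk
    have hi : {z ∈ circlePoints (p * n) | (p : ℤ) ∣ a * z.1 + b * z.2 ∧
          (p : ℤ) ∣ b * z.1 - a * z.2} ∩ {z ∈ circlePoints (p * n) |
          (p : ℤ) ∣ a * z.1 + -b * z.2 ∧ (p : ℤ) ∣ -b * z.1 - a * z.2} =
        {z ∈ circlePoints (p * n) | (p : ℤ) ∣ z.1 ∧ (p : ℤ) ∣ z.2} := by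
      ext ⟨x, y⟩
      simp only [Set.mem_inter_iff, Set.mem_sep_iff]
      constructor
      · rintro ⟨⟨hz, h1, -⟩, -, h2, -⟩
        refine ⟨hz, (hpZ.dvd_or_dvd (a := 2 * a) ?_).resolve_left hap,
          (hpZ.dvd_or_dvd (a := 2 * b) ?_).resolve_left hbp⟩
        · convert dvd_add h1 h2 using 1; ring
        · convert dvd_sub h1 h2 using 1; ring
      · rintro ⟨hz, h1, h2⟩
        have := fun c d : ℤ => dvd_add (h1.mul_left c) (h2.mul_left d)
        have := fun c d : ℤ => dvd_sub (h1.mul_left c) (h2.mul_left d)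
        tauto
    have := Set.ncard_union_add_ncard_inter
      {z ∈ circlePoints (p * n) | (p : ℤ) ∣ a * z.1 + b * z.2 ∧ (p : ℤ) ∣ b * z.1 - a * z.2}
      {z ∈ circlePoints (p * n) | (p : ℤ) ∣ a * z.1 + -b * z.2 ∧ (p : ℤ) ∣ -b * z.1 - a * z.2}
      ((circlePoints_finite _).subset (Set.sep_subset _ _))
      ((circlePoints_finite _).subset (Set.sep_subset _ _))
    rw [hu, hi, hA, hB] at this
    rw [hchi]
    zify at this
    linarith
  · have hchi : chiNeg4 p = -1 := by
      rw [chiNeg4, if_neg (by omega), if_pos (by omega)]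
    rw [hchi, Set.sep_eq_self_iff_mem_true.2]
    · ring
    · rintro ⟨x, y⟩ hz
      simp only [circlePoints, Set.mem_ofPred_eq] at hz
      have h : (p : ℤ) ∣ x ^ 2 + y ^ 2 := by rw [hz]; simp
      exact ⟨dvd_of_dvd_sq_add_sq hp h3 (by rwa [add_comm]), dvd_of_dvd_sq_add_sq hp h3 h⟩

lemma ncard_circlePoints_one : (circlePoints 1).ncard = 4 := by
  have : circlePoints 1 = (({(1, 0), (-1, 0), (0, 1), (0, -1)} : Finset (ℤ × ℤ)) : Set _) := by
    ext ⟨x, y⟩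
    simp only [circlePoints, Set.mem_ofPred_eq, Nat.cast_one, Finset.coe_insert,
      Finset.coe_singleton, Set.mem_insert_iff, Set.mem_singleton_iff, Prod.mk.injEq]
    constructor
    · intro h
      have hx : -1 ≤ x ∧ x ≤ 1 := abs_le.1 (abs_le_of_sq_add_sq h)
      have hy : -1 ≤ y ∧ y ≤ 1 := abs_le.1 (abs_le_of_sq_add_sq ((add_comm _ _).trans h))
      obtain ⟨hx1, hx2⟩ := hx
      obtain ⟨hy1, hy2⟩ := hy
      interval_cases x <;> interval_cases y <;> simp_all
    · rintro (⟨rfl, rfl⟩ | ⟨rfl, rfl⟩ | ⟨rfl, rfl⟩ | ⟨rfl, rfl⟩) <;> norm_num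
  rw [this, Set.ncard_coe_finset]
  rfl

/-- Jacobi's two-square theorem for odd numbers. -/
theorem ncard_circlePoints {n : ℕ} (hn : Odd n) :
    ((circlePoints n).ncard : ℤ) = 4 * chiDivisorSum n := by
  induction n using Nat.strong_induction_on with
  | _ n ih =>
    by_cases h1 : n = 1
    · subst h1
      rw [ncard_circlePoints_one]
      rfl
    · obtain ⟨p, hp, m, rfl⟩ := Nat.exists_prime_and_dvd h1
      obtain ⟨hpo, hmo⟩ := Nat.odd_mul.1 hn
      have hlt : m < p * m := lt_mul_of_one_lt_left hmo.pos hp.one_lt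
      rw [ncard_circlePoints_prime_mul hp hpo, chiDivisorSum_prime_mul hp hmo.pos.ne',
        ih m hlt hmo]
      split_ifs with h
      · have hle : m / p ≤ m := Nat.div_le_self _ _
        rw [ih (m / p) (hle.trans_lt hlt) (hmo.of_dvd_nat (Nat.div_dvd_of_dvd h))]
        ring
      · ring

/-- The pairs of natural numbers whose triangular numbers sum to `k`. -/
def trianglePairs (k : ℕ) : Finset (ℕ × ℕ) :=
  (Finset.range (k + 1) ×ˢ Finset.range (k + 1)).filter fun p =>
    p.1 * (p.1 + 1) / 2 + p.2 * (p.2 + 1) / 2 = k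

lemma two_mul_triangle (x : ℕ) : 2 * (x * (x + 1) / 2) = x * (x + 1) :=
  Nat.two_mul_div_two_of_even (Nat.even_mul_succ_self x)

lemma le_triangle (x : ℕ) : x ≤ x * (x + 1) / 2 := by
  have := two_mul_triangle x
  rcases Nat.eq_zero_or_pos x with rfl | hx
  · simp
  · nlinarith

lemma mem_trianglePairs {k x y : ℕ} :
    (x, y) ∈ trianglePairs k ↔ x * (x + 1) / 2 + y * (y + 1) / 2 = k := by
  simp only [trianglePairs, Finset.mem_filter, Finset.mem_product, Finset.mem_range,
    and_iff_right_iff_imp]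
  have := le_triangle x
  have := le_triangle y
  omega

lemma mem_trianglePairs_iff {k x y : ℕ} :
    (x, y) ∈ trianglePairs k ↔ (x : ℤ) * (x + 1) + y * (y + 1) = 2 * k := by
  rw [mem_trianglePairs]
  have hx := two_mul_triangle x
  have hy := two_mul_triangle y
  zify at hx hy ⊢
  rw [← hx, ← hy, ← mul_add]
  omega

lemma card_trianglePairs (k : ℕ) :
    ((trianglePairs k).card : ℤ) = chiDivisorSum (4 * k + 1) := by
  let B : Set (ℤ × ℤ) := {z | z.1 * (z.1 + 1) + z.2 * (z.2 + 1) = 2 * (k : ℤ)}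
  have hB : B.ncard = (circlePoints (4 * k + 1)).ncard := by
    refine Set.ncard_congr (fun z _ => (z.1 - z.2, z.1 + z.2 + 1)) ?_ ?_ ?_
    · rintro ⟨x, y⟩ h
      simp only [B, circlePoints, Set.mem_ofPred_eq] at h ⊢
      push_cast
      linear_combination 2 * h
    · rintro ⟨x, y⟩ ⟨u, v⟩ - - h
      simp only [Prod.mk.injEq] at h ⊢
      omega
    · rintro ⟨u, v⟩ h
      simp only [circlePoints, Set.mem_ofPred_eq] at h
      have huv : Odd (u + v) := by
        have : Odd (u ^ 2 + v ^ 2) := by rw [h]; exact ⟨2 * k, by push_cast; ring⟩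
        simpa [Int.odd_add, Int.odd_pow, Int.even_pow] using this
      obtain ⟨j, hj⟩ := huv
      obtain rfl : v = 2 * j + 1 - u := by omega
      refine ⟨(j, j - u), ?_, ?_⟩
      · simp only [B, Set.mem_ofPred_eq]
        push_cast at h
        linarith
      · simp only [Prod.mk.injEq]
        constructor <;> ring
  have hP : ((trianglePairs k ×ˢ (Finset.univ : Finset (Bool × Bool)) :
      Finset ((ℕ × ℕ) × Bool × Bool)) : Set ((ℕ × ℕ) × Bool × Bool)).ncard = B.ncard := by
    let s : Bool → ℕ → ℤ := fun b x => if b then x else -1 - x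
    have hs : ∀ b x, s b x * (s b x + 1) = (x : ℤ) * (x + 1) := by
      intro b x
      cases b <;> simp only [s, Bool.false_eq_true, if_true, if_false]
      ring
    have hinj : ∀ b x c y, s b x = s c y → b = c ∧ x = y := by
      intro b x c y h
      cases b <;> cases c <;> simp [s] at h ⊢ <;> omega
    have hsurj : ∀ z, ∃ b x, s b x = z := by
      intro z
      rcases le_or_gt 0 z with hz | hz
      · exact ⟨true, z.toNat, by simp [s, hz]⟩
      · exact ⟨false, (-1 - z).toNat, by simp [s]; omega⟩
    refine Set.ncard_congr (fun p _ => (s p.2.1 p.1.1, s p.2.2 p.1.2)) ?_ ?_ ?_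
    · rintro ⟨⟨x, y⟩, b, c⟩ h
      simp only [Finset.coe_product, Finset.coe_univ, Set.mem_prod, Finset.mem_coe,
        mem_trianglePairs_iff, Set.mem_univ, and_true] at h
      simp only [B, Set.mem_ofPred_eq, hs, h]
    · rintro ⟨⟨x, y⟩, b, c⟩ ⟨⟨x', y'⟩, b', c'⟩ - - h
      simp only [Prod.mk.injEq] at h ⊢
      have h1 := hinj _ _ _ _ h.1
      have h2 := hinj _ _ _ _ h.2
      tauto
    · rintro ⟨u, v⟩ h
      obtain ⟨b, x, rfl⟩ := hsurj u
      obtain ⟨c, y, rfl⟩ := hsurj v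
      refine ⟨((x, y), b, c), ?_, rfl⟩
      simp only [B, Set.mem_ofPred_eq, hs] at h
      simpa only [Finset.coe_product, Finset.coe_univ, Set.mem_prod, Finset.mem_coe,
        mem_trianglePairs_iff, Set.mem_univ, and_true] using h
  rw [hB, Set.ncard_coe_finset, Finset.card_product] at hP
  have h := ncard_circlePoints (n := 4 * k + 1) ⟨2 * k, by ring⟩
  rw [← hP] at h
  simp at h
  linarith

lemma chiDivisorSum_eq_zero {n : ℕ} (hn : n % 4 = 3) : chiDivisorSum n = 0 := by
  have h := ncard_circlePoints (n := n) (by rw [Nat.odd_iff]; omega)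
  have : circlePoints n = ∅ := by
    rw [Set.eq_empty_iff_forall_notMem]
    rintro ⟨x, y⟩ h
    simp only [circlePoints, Set.mem_ofPred_eq] at h
    rcases Int.even_or_odd' x with ⟨i, rfl | rfl⟩ <;> rcases Int.even_or_odd' y with ⟨j, rfl | rfl⟩ <;>
      ring_nf at h <;> omega
  rw [this, Set.ncard_empty] at h
  simpa using h.symm

open Finset.HasAntidiagonal (antidiagonal mem_antidiagonal)

lemma sum_antidiagonal_odd_mul (n : ℕ) (f g : ℕ × ℕ → ℤ) :
    ∑ p ∈ antidiagonal (2 * n) with Odd p.1,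
      (∑ u ∈ p.1.divisorsAntidiagonal, f u) * (∑ v ∈ p.2.divisorsAntidiagonal, g v) =
    ∑ q ∈ oddQuads n, f (q.1, q.2.1) * g q.2.2 := by
  simp_rw [Finset.sum_mul_sum, ← Finset.sum_product']
  rw [Finset.sum_sigma']
  refine Finset.sum_nbij' (fun r => (r.2.1.1, r.2.1.2, r.2.2))
    (fun q => ⟨(q.1 * q.2.1, q.2.2.1 * q.2.2.2), (q.1, q.2.1), q.2.2⟩) ?_ ?_ ?_ ?_ ?_
  · rintro ⟨⟨i, j⟩, ⟨a, x⟩, b, y⟩ h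
    simp only [Finset.mem_sigma, Finset.mem_filter, mem_antidiagonal, Finset.mem_product,
      Nat.mem_divisorsAntidiagonal] at h
    obtain ⟨⟨h, ho⟩, ⟨rfl, -⟩, rfl, -⟩ := h
    rw [mem_oddQuads]
    have hj : Odd (b * y) := by rw [Nat.odd_iff] at ho ⊢; omega
    rw [Nat.odd_mul] at ho hj
    exact ⟨⟨ho.1, ho.2, hj.1, hj.2⟩, h⟩
  · rintro ⟨a, x, b, y⟩ h
    obtain ⟨⟨ha, hx, hb, hy⟩, h⟩ := mem_oddQuads.1 h
    simp only [Finset.mem_sigma, Finset.mem_filter, mem_antidiagonal, Finset.mem_product,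
      Nat.mem_divisorsAntidiagonal]
    exact ⟨⟨h, ha.mul hx⟩, ⟨trivial, (ha.mul hx).pos.ne'⟩, trivial, (hb.mul hy).pos.ne'⟩
  · rintro ⟨⟨i, j⟩, ⟨a, x⟩, b, y⟩ h
    simp only [Finset.mem_sigma, Finset.mem_filter, mem_antidiagonal, Finset.mem_product,
      Nat.mem_divisorsAntidiagonal] at h
    obtain ⟨-, ⟨rfl, -⟩, rfl, -⟩ := h
    rfl
  · exact fun _ _ => rfl
  · exact fun _ _ => rfl

lemma sum_divisorsAntidiagonal_fst (n : ℕ) (f : ℕ → ℤ) :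
    ∑ u ∈ n.divisorsAntidiagonal, f u.1 = ∑ d ∈ n.divisors, f d :=
  Nat.sum_divisorsAntidiagonal fun d _ => f d

lemma sum_divisorsAntidiagonal_snd (n : ℕ) (f : ℕ → ℤ) :
    ∑ u ∈ n.divisorsAntidiagonal, f u.2 = ∑ d ∈ n.divisors, f d :=
  Nat.sum_divisorsAntidiagonal' fun _ d => f d

lemma filter_odd_sum_chiDivisorSum (n : ℕ) (g : ℕ → ℤ) :
    ∑ p ∈ antidiagonal n with Odd p.1, chiDivisorSum p.1 * g p.2 =
      ∑ p ∈ antidiagonal n with p.1 % 4 = 1, chiDivisorSum p.1 * g p.2 := by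
  rw [Finset.sum_filter, Finset.sum_filter]
  refine Finset.sum_congr rfl fun p _ => ?_
  by_cases h : p.1 % 4 = 3
  · simp [chiDivisorSum_eq_zero h]
  · simp only [Nat.odd_iff]
    exact if_congr (by omega) rfl rfl

lemma sum_antidiagonal_chiDivisorSum_mul (s : ℕ) :
    ∑ p ∈ antidiagonal s, chiDivisorSum (4 * p.1 + 1) * chiDivisorSum (4 * p.2 + 1) =
      ∑ d ∈ (2 * s + 1).divisors, (d : ℤ) := by
  have h := sum_antidiagonal_odd_mul (2 * s + 1) (fun u => chiNeg4 u.1) (fun u => chiNeg4 u.1)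
  simp only [sum_divisorsAntidiagonal_fst _ fun d => chiNeg4 d] at h
  rw [sum_chiNeg4_mul_chiNeg4 ⟨s, rfl⟩] at h
  rw [← h]
  refine Eq.trans ?_ (filter_odd_sum_chiDivisorSum _ chiDivisorSum).symm
  refine Finset.sum_nbij' (fun p => (4 * p.1 + 1, 4 * p.2 + 1)) (fun p => (p.1 / 4, p.2 / 4))
    ?_ ?_ ?_ ?_ (fun _ _ => rfl) <;>
  · rintro ⟨i, j⟩ hp
    simp only [Finset.mem_filter, mem_antidiagonal, Prod.mk.injEq] at hp ⊢
    omega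

lemma mem_convPairs {m s l : ℕ} : (s, l) ∈ convPairs m ↔ s + 2 * l = m := by
  simp only [convPairs, Finset.mem_filter, Finset.mem_product, Finset.mem_range]
  omega

lemma sum_convPairs_divisors_mul {n : ℕ} (hn : 1 ≤ n) :
    ∑ p ∈ convPairs (n - 1),
        (∑ d ∈ (2 * p.1 + 1).divisors, (d : ℤ)) * chiDivisorSum (4 * p.2 + 1) =
      ∑ d ∈ n.divisors, chiNeg4 ((n / d : ℕ) : ℤ) * (d : ℤ) ^ 2 := by
  have h := sum_antidiagonal_odd_mul n (fun u => chiNeg4 u.2) (fun u => (u.1 : ℤ))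
  simp only [sum_divisorsAntidiagonal_snd _ fun d => chiNeg4 d,
    sum_divisorsAntidiagonal_fst _ fun d => (d : ℤ)] at h
  rw [← sum_chiNeg4_mul_right hn, ← h]
  refine Eq.trans ?_ (filter_odd_sum_chiDivisorSum _ fun j => ∑ d ∈ j.divisors, (d : ℤ)).symm
  refine Finset.sum_nbij' (fun p => (4 * p.2 + 1, 2 * p.1 + 1)) (fun p => (p.2 / 2, p.1 / 4))
    ?_ ?_ ?_ ?_ (fun _ _ => mul_comm _ _) <;>
  · rintro ⟨i, j⟩ hp
    simp only [Finset.mem_filter, mem_antidiagonal, mem_convPairs, Prod.mk.injEq] at hp ⊢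
    omega

lemma deltaRep_eq_sum (m : ℕ) :
    deltaRep 6 ![1, 1, 1, 1, 2, 2] m =
      ∑ p ∈ convPairs m, (∑ r ∈ antidiagonal p.1,
        (trianglePairs r.1).card * (trianglePairs r.2).card) * (trianglePairs p.2).card := by
  simp_rw [← Finset.card_product, ← Finset.card_sigma, ← Finset.card_product, ← Finset.card_sigma]
  rw [← Set.ncard_coe_finset, deltaRep]
  symm
  refine Set.ncard_congr (fun z _ =>
    ![z.2.1.2.1.1, z.2.1.2.1.2, z.2.1.2.2.1, z.2.1.2.2.2, z.2.2.1, z.2.2.2]) ?_ ?_ ?_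
  · rintro ⟨⟨s, l⟩, ⟨⟨i, j⟩, ⟨x₀, x₁⟩, x₂, x₃⟩, x₄, x₅⟩ h
    simp only [Finset.mem_coe, Finset.mem_sigma, Finset.mem_product, mem_convPairs,
      mem_trianglePairs, mem_antidiagonal] at h
    simp only [Set.mem_ofPred_eq, Fin.sum_univ_succ, Fin.sum_univ_zero]
    simp
    omega
  · rintro ⟨⟨s, l⟩, ⟨⟨i, j⟩, ⟨x₀, x₁⟩, x₂, x₃⟩, x₄, x₅⟩
      ⟨⟨s', l'⟩, ⟨⟨i', j'⟩, ⟨y₀, y₁⟩, y₂, y₃⟩, y₄, y₅⟩ h h' e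
    simp only [Finset.mem_coe, Finset.mem_sigma, Finset.mem_product, mem_convPairs,
      mem_trianglePairs, mem_antidiagonal] at h h'
    simp only [Matrix.vecCons_inj, and_true] at e
    obtain ⟨rfl, rfl, rfl, rfl, rfl, rfl⟩ := e
    obtain ⟨-, ⟨rfl, rfl, rfl⟩, rfl⟩ := h
    obtain ⟨-, ⟨rfl, rfl, rfl⟩, rfl⟩ := h'
    rfl
  · intro x hx
    let T : ℕ → ℕ := fun a => a * (a + 1) / 2
    refine ⟨⟨(T (x 0) + T (x 1) + (T (x 2) + T (x 3)), T (x 4) + T (x 5)),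
      ⟨(T (x 0) + T (x 1), T (x 2) + T (x 3)), (x 0, x 1), x 2, x 3⟩, x 4, x 5⟩, ?_, ?_⟩
    rotate_left
    · ext i
      fin_cases i <;> rfl
    · simp only [Finset.mem_coe, Finset.mem_sigma, Finset.mem_product, mem_convPairs,
        mem_trianglePairs, mem_antidiagonal]
      refine ⟨?_, ⟨trivial, rfl, rfl⟩, rfl⟩
      simp [Fin.sum_univ_six] at hx
      simp only [T]
      omega

theorem delta_111122_formula (n : ℕ) (hn : 1 ≤ n) :
    (deltaRep 6 ![1, 1, 1, 1, 2, 2] (n - 1) : ℤ) =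
      ∑ d ∈ n.divisors, chiNeg4 ((n / d : ℕ) : ℤ) * (d : ℤ) ^ 2 := by
  rw [deltaRep_eq_sum, ← sum_convPairs_divisors_mul hn]
  push_cast
  simp_rw [card_trianglePairs, sum_antidiagonal_chiDivisorSum_mul]
end
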